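/- arXiv:1105.0245 — 3 statements merged into one kernel-verified Lean document; each statement's English description precedes it below -/
import Mathlib

section
/- For every natural number n and every complex number x, C_n(x) = ((2i)^{n+1}/(n+1))·( −B_{n+1}(x/(2i)) + B_{n+1}(1/2) ) + xⁿ·(x − i). -/
open Polynomial Finset

/-- The pair of polynomial sequences (Aₙ, Cₙ) from the paper:
A₀ = X, C₀ = 0, and
A_{n+1} = ((n+1)/(n+2))·(X·Aₙ + ∑_{k=0}^{n} λₙᵏ·A_k),
C_{n+1} = ((n+1)/(n+2))·((X²+1)·Xⁿ + ∑_{k=0}^{n} λₙᵏ·C_k),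
where λₙᵏ is the coefficient of Xᵏ in Cₙ. -/
noncomputable def AC : ℕ → Polynomial ℂ × Polynomial ℂ
  | 0 => (Polynomial.X, 0)
  | (n+1) =>
    (((n+1 : ℂ)/(n+2)) • (Polynomial.X * (AC n).1 +
        ∑ k ∈ (Finset.range (n+1)).attach, ((AC n).2.coeff k) • (AC k).1),
     ((n+1 : ℂ)/(n+2)) • ((Polynomial.X^2 + 1) * Polynomial.X^n +
        ∑ k ∈ (Finset.range (n+1)).attach, ((AC n).2.coeff k) • (AC k).2))
  decreasing_by
  all_goals first
    | exact Nat.lt_succ_self n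
    | exact Nat.lt_succ_of_lt (Finset.mem_range.mp k.2)
    | exact Finset.mem_range.mp k.2

noncomputable def polyA (n : ℕ) : Polynomial ℂ := (AC n).1
noncomputable def polyC (n : ℕ) : Polynomial ℂ := (AC n).2

theorem polyC_zero : polyC 0 = 0 := by simp [polyC, AC]

theorem polyC_succ (n : ℕ) : polyC (n+1) =
    ((n+1 : ℂ)/(n+2)) • ((Polynomial.X^2 + 1) * Polynomial.X^n +
        ∑ k ∈ Finset.range (n+1), ((polyC n).coeff k) • polyC k) := by
  rw [polyC, AC]
  simp only [polyC]
  rw [← Finset.sum_attach (Finset.range (n+1))]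

theorem polyC_deg (n : ℕ) : (polyC n).natDegree ≤ n + 1 := by
  induction n using Nat.strong_induction_on with
  | _ n ih =>
    cases n with
    | zero => simp [polyC_zero]
    | succ n =>
      rw [polyC_succ]
      refine (natDegree_smul_le _ _).trans ?_
      refine natDegree_add_le_of_degree_le ?_ ?_
      · compute_degree
        omega
      · refine natDegree_sum_le_of_forall_le _ _ ?_
        intro k hk
        have hk' := Finset.mem_range.mp hk
        refine (natDegree_smul_le _ _).trans ?_
        have := ih k hk'
        omega

theorem polyC_top (n : ℕ) : (polyC n).coeff (n + 1) = (n : ℂ) / (n + 1) := by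
  cases n with
  | zero => simp [polyC_zero]
  | succ n =>
    rw [polyC_succ, coeff_smul, coeff_add, finset_sum_coeff, Finset.sum_eq_zero]
    · have h : ((X ^ 2 + 1 : ℂ[X]) * X ^ n).coeff (n + 1 + 1) = 1 := by
        rw [show n + 1 + 1 = 2 + n by ring, coeff_mul_X_pow]
        simp [coeff_one]
      rw [h]
      push_cast
      simp
      ring
    · intro k hk
      have hk' := Finset.mem_range.mp hk
      rw [coeff_smul, coeff_eq_zero_of_natDegree_lt (p := polyC k), smul_zero]
      have := polyC_deg k
      omega

theorem polyC_sum (n : ℕ) (y : ℂ) :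
    ∑ k ∈ Finset.range (n+1), (polyC n).coeff k * y ^ k
      = (polyC n).eval y - (n : ℂ) / (n + 1) * y ^ (n + 1) := by
  rw [eval_eq_sum_range' (n := n + 2) (by have := polyC_deg n; omega),
    Finset.sum_range_succ _ (n + 1), polyC_top]
  ring

theorem polyC_I (n : ℕ) : (polyC n).eval Complex.I = 0 := by
  induction n using Nat.strong_induction_on with
  | _ n ih =>
    cases n with
    | zero => simp [polyC_zero]
    | succ n =>
      rw [polyC_succ, eval_smul, eval_add, eval_finset_sum, Finset.sum_eq_zero]
      · simp
      · intro k hk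
        rw [eval_smul, ih k (Finset.mem_range.mp hk), smul_zero]

theorem polyC_diff (n : ℕ) (x : ℂ) :
    (polyC n).eval (x + 2 * Complex.I) - (polyC n).eval x =
      (x + Complex.I) * ((x + 2 * Complex.I) ^ n - x ^ n) := by
  induction n using Nat.strong_induction_on with
  | _ n ih =>
    cases n with
    | zero => simp [polyC_zero]
    | succ n =>
      have h1 : ∑ k ∈ Finset.range (n+1), (polyC n).coeff k * (polyC k).eval (x + 2 * Complex.I)
          - ∑ k ∈ Finset.range (n+1), (polyC n).coeff k * (polyC k).eval x
          = (x + Complex.I) * (∑ k ∈ Finset.range (n+1), (polyC n).coeff k * (x + 2 * Complex.I) ^ k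
          - ∑ k ∈ Finset.range (n+1), (polyC n).coeff k * x ^ k) := by
        rw [← Finset.sum_sub_distrib, ← Finset.sum_sub_distrib, Finset.mul_sum]
        refine Finset.sum_congr rfl fun k hk => ?_
        have := ih k (Finset.mem_range.mp hk)
        linear_combination (polyC n).coeff k * this
      rw [polyC_sum, polyC_sum] at h1
      have h2 := ih n (Nat.lt_succ_self n)
      rw [polyC_succ]
      simp only [eval_smul, eval_add, eval_finset_sum, smul_eq_mul, eval_mul, eval_pow, eval_X,
        eval_one]
      have hn1 : (n : ℂ) + 1 ≠ 0 := by exact_mod_cast Nat.succ_ne_zero n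
      have hn2 : (n : ℂ) + 2 ≠ 0 := by exact_mod_cast Nat.succ_ne_zero (n + 1)
      have hI : Complex.I ^ 2 = -1 := Complex.I_sq
      have key : ((x + 2 * Complex.I) ^ 2 + 1) * (x + 2 * Complex.I) ^ n - (x ^ 2 + 1) * x ^ n
          + (x + Complex.I) * ((x + Complex.I) * ((x + 2 * Complex.I) ^ n - x ^ n)
            - (n : ℂ) / (n + 1) * ((x + 2 * Complex.I) ^ (n + 1) - x ^ (n + 1)))
          = ((n : ℂ) + 2) / (n + 1) *
            ((x + Complex.I) * ((x + 2 * Complex.I) ^ (n + 1) - x ^ (n + 1))) := by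
        rw [pow_succ (x + 2 * Complex.I) n, pow_succ x n]
        generalize (x + 2 * Complex.I) ^ n = b
        generalize x ^ n = a
        field_simp
        linear_combination ((n : ℂ) + 1) * (b - a) * hI
      have hu : ((n : ℂ) + 1) / (n + 2) * (((n : ℂ) + 2) / (n + 1)) = 1 := by
        field_simp
      linear_combination ((n : ℂ) + 1) / (n + 2) * (h1 + (x + Complex.I) * h2 + key)
        + ((x + Complex.I) * ((x + 2 * Complex.I) ^ (n + 1) - x ^ (n + 1))) * hu

theorem bern_diff (n : ℕ) (y : ℂ) :
    aeval (y + 1) (Polynomial.bernoulli (n + 1)) =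
      aeval y (Polynomial.bernoulli (n + 1)) + (n + 1) * y ^ n := by
  have h := congrArg (aeval y) (Polynomial.bernoulli_comp_one_add_X (n + 1))
  rw [aeval_comp] at h
  simp at h
  rw [add_comm y 1, h]

/-- The right-hand side as a polynomial. -/
noncomputable def rhsP (n : ℕ) : ℂ[X] :=
  C ((2 * Complex.I) ^ (n + 1) / (n + 1)) *
    (-((Polynomial.bernoulli (n + 1)).map (algebraMap ℚ ℂ)).comp (C (1 / (2 * Complex.I)) * X) +
      C (aeval ((1 : ℂ) / 2) (Polynomial.bernoulli (n + 1)))) + X ^ n * (X - C Complex.I)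

theorem rhsP_eval (n : ℕ) (x : ℂ) : (rhsP n).eval x =
      ((2 * Complex.I) ^ (n + 1) / (n + 1)) *
        (-(Polynomial.aeval (x / (2 * Complex.I)) (Polynomial.bernoulli (n + 1))) +
          Polynomial.aeval ((1 : ℂ) / 2) (Polynomial.bernoulli (n + 1))) +
      x ^ n * (x - Complex.I) := by
  have e : 1 / (2 * Complex.I) * x = x / (2 * Complex.I) := by ring
  simp only [rhsP, eval_add, eval_mul, eval_C, eval_neg, eval_comp, eval_X, eval_pow, eval_sub,
    eval_map_algebraMap, e]

theorem rhsP_I (n : ℕ) : (rhsP n).eval Complex.I = 0 := by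
  have e : Complex.I / (2 * Complex.I) = 1 / 2 := by
    field_simp
  rw [rhsP_eval, e]
  simp

theorem rhsP_diff (n : ℕ) (x : ℂ) :
    (rhsP n).eval (x + 2 * Complex.I) - (rhsP n).eval x =
      (x + Complex.I) * ((x + 2 * Complex.I) ^ n - x ^ n) := by
  have h0 : (2 * Complex.I) ≠ 0 := by simp
  have hn1 : (n : ℂ) + 1 ≠ 0 := by exact_mod_cast Nat.succ_ne_zero n
  have e : (x + 2 * Complex.I) / (2 * Complex.I) = x / (2 * Complex.I) + 1 := by
    rw [add_div, div_self h0]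
  rw [rhsP_eval, rhsP_eval, e, bern_diff]
  have k : (2 * Complex.I) ^ (n + 1) / (n + 1) * (((n : ℂ) + 1) * (x / (2 * Complex.I)) ^ n)
      = 2 * Complex.I * x ^ n := by
    rw [div_pow, pow_succ]
    have := pow_ne_zero n h0
    generalize (2 * Complex.I) ^ n = t at *
    field_simp
  linear_combination -k

theorem polyC_eq (n : ℕ) : polyC n = rhsP n := by
  have hk : ∀ k : ℕ, (polyC n).eval (Complex.I + k * (2 * Complex.I))
      = (rhsP n).eval (Complex.I + k * (2 * Complex.I)) := by
    intro k
    induction k with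
    | zero => simp [polyC_I, rhsP_I]
    | succ k ih =>
      have e : Complex.I + ((k + 1 : ℕ) : ℂ) * (2 * Complex.I)
          = Complex.I + k * (2 * Complex.I) + 2 * Complex.I := by
        push_cast
        ring
      rw [e]
      linear_combination ih + polyC_diff n (Complex.I + k * (2 * Complex.I))
        - rhsP_diff n (Complex.I + k * (2 * Complex.I))
  refine eq_of_infinite_eval_eq _ _ ?_
  refine (Set.infinite_range_of_injective
    (f := fun k : ℕ => Complex.I + k * (2 * Complex.I)) ?_).mono ?_
  · intro a b h
    simpa using h
  · rintro _ ⟨k, rfl⟩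
    exact hk k

theorem stmt6 (n : ℕ) (x : ℂ) :
    (polyC n).eval x =
      ((2 * Complex.I) ^ (n + 1) / (n + 1)) *
        (-(Polynomial.aeval (x / (2 * Complex.I)) (Polynomial.bernoulli (n + 1))) +
          Polynomial.aeval ((1 : ℂ) / 2) (Polynomial.bernoulli (n + 1))) +
      x ^ n * (x - Complex.I) := by
  rw [polyC_eq, rhsP_eval]
end

section
/- For every natural number n and every real number z < 0, (1 − e^z)·∫_{0}^{∞} (ln t)ⁿ/((t + 1)·(t + e^z)) dt = −π^{n+1}·A_n(z/π), where the integral is taken over the open interval (0, ∞) and A_n(z/π) denotes evaluation of A_n at the complex number z/π. -/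
open Polynomial Finset

namespace Stmt16Aux

open PowerSeries in
lemma deriv_sin (A : Type*) [CommRing A] [Algebra ℚ A] :
    PowerSeries.derivative A (PowerSeries.sin A) = PowerSeries.cos A := by
  ext n
  rw [PowerSeries.coeff_derivative]
  simp only [PowerSeries.sin, PowerSeries.cos, PowerSeries.coeff_mk]
  have hn : ((n : A) + 1) = algebraMap ℚ A ((n : ℚ) + 1) := by simp
  rcases Nat.even_or_odd n with h | h
  · have h1 : ¬ Even (n + 1) := by rw [Nat.even_add_one]; simpa using h
    rw [if_neg h1, if_pos h, hn, ← map_mul]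
    congr 1
    have h2 : (n + 1) / 2 = n / 2 := by obtain ⟨m, rfl⟩ := h; omega
    rw [h2, Nat.factorial_succ]
    push_cast
    field_simp
  · have h1 : Even (n + 1) := by rw [Nat.even_add_one]; simpa using h
    have h3 : ¬ Even n := by simpa using h
    rw [if_pos h1, if_neg h3, zero_mul]

open PowerSeries in
lemma deriv_cos (A : Type*) [CommRing A] [Algebra ℚ A] :
    PowerSeries.derivative A (PowerSeries.cos A) = - PowerSeries.sin A := by
  ext n
  rw [PowerSeries.coeff_derivative, map_neg]
  simp only [PowerSeries.sin, PowerSeries.cos, PowerSeries.coeff_mk]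
  have hn : ((n : A) + 1) = algebraMap ℚ A ((n : ℚ) + 1) := by simp
  rcases Nat.even_or_odd n with h | h
  · have h1 : ¬ Even (n + 1) := by rw [Nat.even_add_one]; simpa using h
    rw [if_neg h1, if_pos h, zero_mul, neg_zero]
  · have h1 : Even (n + 1) := by rw [Nat.even_add_one]; simpa using h
    have h3 : ¬ Even n := by simpa using h
    rw [if_pos h1, if_neg h3, hn, ← map_mul, ← map_neg]
    congr 1
    have h2 : (n + 1) / 2 = n / 2 + 1 := by obtain ⟨m, rfl⟩ := h; omega
    rw [h2, Nat.factorial_succ, pow_succ]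
    push_cast
    field_simp

lemma deriv_rescale_exp (A : Type*) [CommRing A] [Algebra ℚ A] (a : A) :
    PowerSeries.derivative A (PowerSeries.rescale a (PowerSeries.exp A)) =
      PowerSeries.C a * PowerSeries.rescale a (PowerSeries.exp A) := by
  ext n
  rw [PowerSeries.coeff_derivative, PowerSeries.coeff_C_mul, PowerSeries.coeff_rescale,
    PowerSeries.coeff_rescale, PowerSeries.coeff_exp, PowerSeries.coeff_exp]
  have hn : ((n : A) + 1) = algebraMap ℚ A ((n : ℚ) + 1) := by simp
  rw [hn, mul_assoc, ← map_mul, Nat.factorial_succ, pow_succ', mul_assoc]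
  congr 3
  push_cast
  field_simp

lemma exists_series : ∃ S P Q : PowerSeries ℂ, P.coeff 0 = 0 ∧ Q.coeff 0 = 0 ∧
    S ≠ 0 ∧ PowerSeries.X * S = PowerSeries.sin ℂ ∧
    PowerSeries.X * P * S = S - PowerSeries.cos ℂ ∧ PowerSeries.X * Q * S = 1 - S := by
  obtain ⟨S, hS⟩ : (PowerSeries.X : PowerSeries ℂ) ∣ PowerSeries.sin ℂ := by
    rw [PowerSeries.X_dvd_iff, ← PowerSeries.coeff_zero_eq_constantCoeff_apply]
    simp [PowerSeries.sin]
  have hS0 : PowerSeries.constantCoeff S = 1 := by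
    have := congrArg (PowerSeries.coeff 1) hS
    rw [show (1:ℕ) = 0 + 1 from rfl, PowerSeries.coeff_succ_X_mul] at this
    rw [← PowerSeries.coeff_zero_eq_constantCoeff_apply, ← this]
    simp [PowerSeries.sin]
  have hS1 : PowerSeries.coeff 1 S = 0 := by
    have := congrArg (PowerSeries.coeff 2) hS
    rw [show (2:ℕ) = 1 + 1 from rfl, PowerSeries.coeff_succ_X_mul] at this
    rw [← this]
    simp [PowerSeries.sin]
  obtain ⟨T, hT⟩ : (PowerSeries.X : PowerSeries ℂ) ∣ S - PowerSeries.cos ℂ := by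
    rw [PowerSeries.X_dvd_iff, map_sub, hS0, ← PowerSeries.coeff_zero_eq_constantCoeff_apply]
    simp [PowerSeries.cos]
  obtain ⟨U, hU⟩ : (PowerSeries.X : PowerSeries ℂ) ∣ 1 - S := by
    rw [PowerSeries.X_dvd_iff, map_sub, hS0]
    simp
  have hi : S⁻¹ * S = 1 := PowerSeries.inv_mul_cancel _ (by rw [hS0]; exact one_ne_zero)
  refine ⟨S, T * S⁻¹, U * S⁻¹, ?_, ?_, ?_, hS.symm, ?_, ?_⟩
  · have := congrArg (PowerSeries.coeff 1) hT
    rw [show (1:ℕ) = 0 + 1 from rfl, PowerSeries.coeff_succ_X_mul, zero_add, map_sub, hS1] at this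
    rw [PowerSeries.coeff_mul, Finset.Nat.antidiagonal_zero, Finset.sum_singleton, ← this]
    simp [PowerSeries.cos]
  · have := congrArg (PowerSeries.coeff 1) hU
    rw [show (1:ℕ) = 0 + 1 from rfl, PowerSeries.coeff_succ_X_mul, zero_add, map_sub, hS1] at this
    rw [PowerSeries.coeff_mul, Finset.Nat.antidiagonal_zero, Finset.sum_singleton, ← this]
    simp [PowerSeries.coeff_one]
  · rintro rfl
    simp at hS0
  · rw [hT]
    linear_combination PowerSeries.X * T * hi
  · rw [hU]
    linear_combination PowerSeries.X * U * hi

noncomputable def Chat (P Q : PowerSeries ℂ) (n : ℕ) : Polynomial ℂ :=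
  Polynomial.C ((n : ℂ) / (n + 1)) * Polynomial.X ^ (n + 1) +
    ∑ k ∈ Finset.range (n + 1),
      Polynomial.C ((n.factorial : ℂ) / k.factorial * P.coeff (n - k)) * Polynomial.X ^ k +
    Polynomial.C ((n.factorial : ℂ) * Q.coeff n)

lemma Chat_coeff (P Q : PowerSeries ℂ) (n k : ℕ) (hk : k ≤ n) :
    (Chat P Q n).coeff k = (n.factorial : ℂ) / k.factorial * P.coeff (n - k) +
      if k = 0 then (n.factorial : ℂ) * Q.coeff n else 0 := by
  unfold Chat
  rw [Polynomial.coeff_add, Polynomial.coeff_add, Polynomial.coeff_C_mul_X_pow,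
    if_neg (by omega), zero_add, Polynomial.finsetSum_coeff, Polynomial.coeff_C]
  congr 1
  simp only [Polynomial.coeff_C_mul_X_pow]
  rw [Finset.sum_eq_single k]
  · simp
  · intro b _ hb
    rw [if_neg (Ne.symm hb)]
  · intro h
    simp at h; omega

/-- The EGF of `Chat`. -/
noncomputable def HH (P Q : PowerSeries ℂ) : PowerSeries (Polynomial ℂ) :=
  PowerSeries.mk fun n => Polynomial.C (1 / (n.factorial : ℂ)) * Chat P Q n

noncomputable abbrev EE : PowerSeries (Polynomial ℂ) :=
  PowerSeries.rescale Polynomial.X (PowerSeries.exp (Polynomial ℂ))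

lemma coeff_EE (n : ℕ) : EE.coeff n = Polynomial.C (1 / (n.factorial : ℂ)) * Polynomial.X ^ n := by
  rw [PowerSeries.coeff_rescale, PowerSeries.coeff_exp, mul_comm]
  congr 1
  rw [IsScalarTower.algebraMap_apply ℚ ℂ (Polynomial ℂ)]
  simp

lemma HH_eq (P Q : PowerSeries ℂ) :
    PowerSeries.X * HH P Q = PowerSeries.C Polynomial.X * PowerSeries.X * EE - (EE - 1) +
      PowerSeries.X * (EE * PowerSeries.map Polynomial.C P + PowerSeries.map Polynomial.C Q) := by
  ext1 n
  rcases n with _ | n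
  · have h0 : PowerSeries.coeff 0 EE = 1 := by rw [coeff_EE]; simp
    rw [mul_assoc, map_add, map_sub, map_sub, h0]
    simp
  · rw [mul_assoc, map_add, map_sub, map_sub, PowerSeries.coeff_C_mul,
      PowerSeries.coeff_succ_X_mul, PowerSeries.coeff_succ_X_mul, PowerSeries.coeff_succ_X_mul,
      map_add, PowerSeries.coeff_mul, PowerSeries.coeff_map, PowerSeries.coeff_one,
      if_neg (Nat.succ_ne_zero n), coeff_EE, coeff_EE,
      Finset.Nat.sum_antidiagonal_eq_sum_range_succ_mk]
    simp only [coeff_EE, PowerSeries.coeff_map, HH, PowerSeries.coeff_mk, Chat]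
    have hf : (n.factorial : ℂ) ≠ 0 := by exact_mod_cast n.factorial_ne_zero
    have hn1 : (n : ℂ) + 1 ≠ 0 := by exact_mod_cast Nat.succ_ne_zero n
    have e1 : (1 / (n.factorial : ℂ) * ((n : ℂ) / (n + 1))) =
        1 / n.factorial - 1 / ((n + 1).factorial : ℂ) := by
      rw [Nat.factorial_succ]
      push_cast
      field_simp
      ring
    have e1' := congrArg (Polynomial.C : ℂ → Polynomial ℂ) e1
    rw [Polynomial.C_mul, Polynomial.C_sub] at e1'
    have e2 : ∀ k ∈ Finset.range (n + 1), Polynomial.C (1 / (n.factorial : ℂ)) *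
        (Polynomial.C ((n.factorial : ℂ) / k.factorial * P.coeff (n - k)) * Polynomial.X ^ k) =
        Polynomial.C (1 / (k.factorial : ℂ)) * Polynomial.X ^ k *
          Polynomial.C (P.coeff (n - k)) := by
      intro k _
      have e : (1 / (n.factorial : ℂ)) * ((n.factorial : ℂ) / k.factorial * P.coeff (n - k)) =
          1 / (k.factorial : ℂ) * P.coeff (n - k) := by field_simp
      have e' := congrArg (Polynomial.C : ℂ → Polynomial ℂ) e
      rw [Polynomial.C_mul, Polynomial.C_mul (a := 1 / (k.factorial : ℂ))] at e'
      linear_combination Polynomial.X ^ k * e'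
    have e3 : (1 / (n.factorial : ℂ)) * ((n.factorial : ℂ) * Q.coeff n) = Q.coeff n := by
      field_simp
    have e3' := congrArg (Polynomial.C : ℂ → Polynomial ℂ) e3
    rw [Polynomial.C_mul] at e3'
    rw [mul_add, mul_add, Finset.mul_sum, Finset.sum_congr rfl e2, e3', ← mul_assoc, e1']
    rw [Nat.succ_eq_add_one]
    ring

lemma HH_rec (S P Q : PowerSeries ℂ) (hS0 : S ≠ 0) (hS : PowerSeries.X * S = PowerSeries.sin ℂ)
    (hP : PowerSeries.X * P * S = S - PowerSeries.cos ℂ)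
    (hQ : PowerSeries.X * Q * S = 1 - S) :
    PowerSeries.X * PowerSeries.derivative _ (HH P Q) + HH P Q =
      PowerSeries.X * (PowerSeries.C (Polynomial.X ^ 2 + 1) * EE +
        HH P Q * PowerSeries.map Polynomial.C P) := by
  have h1 := HH_eq P Q
  have hS' := congrArg (PowerSeries.map (Polynomial.C : ℂ →+* _)) hS
  have hP' := congrArg (PowerSeries.map (Polynomial.C : ℂ →+* _)) hP
  have hQ' := congrArg (PowerSeries.map (Polynomial.C : ℂ →+* _)) hQ
  simp only [map_mul, map_sub, PowerSeries.map_X, PowerSeries.map_sin, PowerSeries.map_cos,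
    map_one] at hS' hP' hQ'
  set S' := PowerSeries.map (Polynomial.C : ℂ →+* _) S with hS'def
  set P' := PowerSeries.map (Polynomial.C : ℂ →+* _) P
  set Q' := PowerSeries.map (Polynomial.C : ℂ →+* _) Q
  have hne : S' ≠ 0 := by
    rw [hS'def, Ne, map_eq_zero_iff _ (PowerSeries.map_injective _ Polynomial.C_injective)]
    exact hS0
  set H := HH P Q
  have h2 : PowerSeries.sin _ * H = PowerSeries.C Polynomial.X * PowerSeries.sin _ * EE
      - EE * PowerSeries.cos _ + 1 := by
    rw [← hS']
    linear_combination S' * h1 + EE * hP' + hQ'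
  have h3 := congrArg (PowerSeries.derivative (Polynomial ℂ)) h2
  simp only [Derivation.leibniz, map_add, map_sub, deriv_sin, deriv_cos, deriv_rescale_exp,
    PowerSeries.derivative_C, PowerSeries.derivative_one, smul_eq_mul] at h3
  apply mul_left_cancel₀ hne
  have h4 : PowerSeries.C ((Polynomial.X : Polynomial ℂ) ^ 2 + 1) =
    PowerSeries.C Polynomial.X ^ 2 + 1 := by simp
  rw [h4]
  rw [← hS'] at h3
  linear_combination h3 - H * hP'

lemma Chat_rec (S P Q : PowerSeries ℂ) (hS0 : S ≠ 0) (hS : PowerSeries.X * S = PowerSeries.sin ℂ)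
    (hP : PowerSeries.X * P * S = S - PowerSeries.cos ℂ)
    (hQ : PowerSeries.X * Q * S = 1 - S) (n : ℕ) :
    Chat P Q (n + 1) = ((n+1 : ℂ)/(n+2)) • ((Polynomial.X^2 + 1) * Polynomial.X^n +
      ∑ k ∈ Finset.range (n + 1), ((n.factorial : ℂ) / k.factorial * P.coeff (n - k)) •
        Chat P Q k) := by
  have h := congrArg (PowerSeries.coeff (n + 1)) (HH_rec S P Q hS0 hS hP hQ)
  rw [map_add, PowerSeries.coeff_succ_X_mul, PowerSeries.coeff_succ_X_mul, map_add,
    PowerSeries.coeff_C_mul, PowerSeries.coeff_derivative, coeff_EE, PowerSeries.coeff_mul,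
    Finset.Nat.sum_antidiagonal_eq_sum_range_succ_mk] at h
  simp only [HH, PowerSeries.coeff_mk, PowerSeries.coeff_map] at h
  have hf : (n.factorial : ℂ) ≠ 0 := by exact_mod_cast n.factorial_ne_zero
  have hn1 : (n : ℂ) + 1 ≠ 0 := by exact_mod_cast Nat.succ_ne_zero n
  have hn2 : (n : ℂ) + 2 ≠ 0 := by exact_mod_cast Nat.succ_ne_zero (n + 1)
  have h' := congrArg (fun p => Polynomial.C ((n.factorial : ℂ) * ((n+1 : ℂ)/(n+2))) * p) h
  have e1 : Polynomial.C ((n.factorial : ℂ) * ((n+1 : ℂ)/(n+2))) *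
    (Polynomial.C (1 / ((n + 1).factorial : ℂ)) * Chat P Q (n + 1) * ((n : Polynomial ℂ) + 1) +
      Polynomial.C (1 / ((n + 1).factorial : ℂ)) * Chat P Q (n + 1)) = Chat P Q (n + 1) := by
    have : ((n : Polynomial ℂ) + 1) = Polynomial.C ((n : ℂ) + 1) := by simp
    rw [this]
    have : Polynomial.C ((n.factorial : ℂ) * ((n+1 : ℂ)/(n+2))) *
      Polynomial.C (1 / ((n + 1).factorial : ℂ)) * (Polynomial.C ((n : ℂ) + 1) + 1) = 1 := by
      rw [← Polynomial.C_1, ← Polynomial.C_add, ← Polynomial.C_mul, ← Polynomial.C_mul]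
      congr 1
      rw [Nat.factorial_succ]
      push_cast
      field_simp
      ring
    linear_combination Chat P Q (n + 1) * this
  rw [e1] at h'
  rw [h', mul_comm (n.factorial : ℂ), Polynomial.C_mul, mul_assoc, Polynomial.smul_eq_C_mul]
  congr 1
  rw [mul_add, Finset.mul_sum]
  congr 1
  · rw [mul_left_comm (Polynomial.C _), ← mul_assoc (Polynomial.C _), ← Polynomial.C_mul]
    rw [mul_one_div_cancel hf, Polynomial.C_1, one_mul]
  · refine Finset.sum_congr rfl fun k _ => ?_
    rw [Polynomial.smul_eq_C_mul, mul_right_comm, ← mul_assoc, ← mul_assoc, ← Polynomial.C_mul,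
      ← Polynomial.C_mul]
    congr 2
    ring

lemma polyA_succ (n : ℕ) : polyA (n + 1) = ((n+1 : ℂ)/(n+2)) • (Polynomial.X * polyA n +
    ∑ k ∈ Finset.range (n + 1), ((polyC n).coeff k) • polyA k) := by
  unfold polyA polyC
  rw [AC]
  simp only
  rw [Finset.sum_attach (Finset.range (n + 1)) (fun k => ((AC n).2.coeff k) • (AC k).1)]

lemma polyC_succ (n : ℕ) : polyC (n + 1) = ((n+1 : ℂ)/(n+2)) •
    ((Polynomial.X^2 + 1) * Polynomial.X^n +
    ∑ k ∈ Finset.range (n + 1), ((polyC n).coeff k) • polyC k) := by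
  unfold polyC
  rw [AC]
  simp only
  rw [Finset.sum_attach (Finset.range (n + 1)) (fun k => ((AC n).2.coeff k) • (AC k).2)]

lemma polyC_eq (S P Q : PowerSeries ℂ) (hS0 : S ≠ 0) (hS : PowerSeries.X * S = PowerSeries.sin ℂ)
    (hP : PowerSeries.X * P * S = S - PowerSeries.cos ℂ)
    (hQ : PowerSeries.X * Q * S = 1 - S) (hP0 : P.coeff 0 = 0) (hQ0 : Q.coeff 0 = 0) (n : ℕ) :
    polyC n = Chat P Q n := by
  have h0 : polyC 0 = 0 := by unfold polyC; rw [AC]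
  induction n using Nat.strong_induction_on with
  | _ n ih =>
    rcases n with _ | n
    · rw [h0]
      simp [Chat, hP0, hQ0]
    · rw [polyC_succ, Chat_rec S P Q hS0 hS hP hQ]
      congr 2
      refine Finset.sum_congr rfl fun k hk => ?_
      have hk' : k < n + 1 := Finset.mem_range.mp hk
      rw [ih n (by omega), Chat_coeff P Q n k (by omega), ← ih k hk']
      rcases k with _ | k
      · rw [h0]; simp
      · simp

lemma A_egf (y : ℂ) :
    PowerSeries.sin ℂ * (PowerSeries.mk fun n => (polyA n).eval y / (n.factorial : ℂ)) =
      PowerSeries.rescale y (PowerSeries.exp ℂ) - 1 := by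
  obtain ⟨S, P, Q, hP0, hQ0, hS0, hS, hP, hQ⟩ := exists_series
  set G : PowerSeries ℂ := PowerSeries.mk fun n => (polyA n).eval y / (n.factorial : ℂ) with hG
  have hA0 : (polyA 0).eval y = y := by unfold polyA; rw [AC]; simp
  have h1 : PowerSeries.X * PowerSeries.derivative ℂ G + G - PowerSeries.C y =
      PowerSeries.X * (PowerSeries.C y * G + G * P + PowerSeries.C y * Q) := by
    ext n
    rcases n with _ | n
    · have : PowerSeries.coeff 0 G = y := by simp [hG, hA0]
      rw [map_sub, map_add, this]
      simp
    · have hf : (n.factorial : ℂ) ≠ 0 := by exact_mod_cast n.factorial_ne_zero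
      have hn1 : (n : ℂ) + 1 ≠ 0 := by exact_mod_cast Nat.succ_ne_zero n
      have hn2 : (n : ℂ) + 2 ≠ 0 := by exact_mod_cast Nat.succ_ne_zero (n + 1)
      rw [map_sub, map_add, PowerSeries.coeff_succ_X_mul, PowerSeries.coeff_succ_X_mul,
        PowerSeries.coeff_C, if_neg (Nat.succ_ne_zero n), map_add, map_add,
        PowerSeries.coeff_C_mul, PowerSeries.coeff_C_mul, PowerSeries.coeff_derivative,
        PowerSeries.coeff_mul, Finset.Nat.sum_antidiagonal_eq_sum_range_succ_mk]
      simp only [hG, PowerSeries.coeff_mk]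
      have hsum : ∑ k ∈ Finset.range (n + 1), (polyC n).coeff k * (polyA k).eval y =
          n.factorial * (∑ k ∈ Finset.range n.succ,
            (polyA k).eval y / (k.factorial : ℂ) * P.coeff (n - k) + y * Q.coeff n) := by
        have : ∀ k ∈ Finset.range (n + 1), (polyC n).coeff k * (polyA k).eval y =
            n.factorial * ((polyA k).eval y / (k.factorial : ℂ) * P.coeff (n - k)) +
            if k = 0 then n.factorial * (y * Q.coeff n) else 0 := by
          intro k hk
          have hk' : k < n + 1 := Finset.mem_range.mp hk
          rw [polyC_eq S P Q hS0 hS hP hQ hP0 hQ0, Chat_coeff P Q n k (by omega)]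
          split_ifs with h0
          · subst h0
            rw [hA0]; ring
          · ring
        rw [Finset.sum_congr rfl this, Finset.sum_add_distrib, ← Finset.mul_sum,
          Finset.sum_ite_eq' (Finset.range (n + 1)) 0, if_pos (by simp), mul_add]
      have hA := congrArg (Polynomial.eval y) (polyA_succ n)
      rw [Polynomial.eval_smul, Polynomial.eval_add, Polynomial.eval_mul, Polynomial.eval_X,
        Polynomial.eval_finsetSum] at hA
      simp only [Polynomial.eval_smul, smul_eq_mul] at hA
      rw [hsum] at hA
      rw [hA, Nat.factorial_succ]
      push_cast
      field_simp
      ring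
  have h2 : PowerSeries.sin ℂ * PowerSeries.derivative ℂ G + PowerSeries.cos ℂ * G =
      PowerSeries.C y * PowerSeries.sin ℂ * G + PowerSeries.C y := by
    rw [← hS]
    linear_combination S * h1 + G * hP + PowerSeries.C y * hQ
  set D : PowerSeries ℂ :=
    PowerSeries.sin ℂ * G - (PowerSeries.rescale y (PowerSeries.exp ℂ) - 1) with hD
  have h3 : PowerSeries.derivative ℂ D = PowerSeries.C y * D := by
    rw [hD]
    simp only [Derivation.leibniz, map_sub, deriv_sin, deriv_rescale_exp,
      PowerSeries.derivative_one, smul_eq_mul]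
    linear_combination h2
  have h4 : ∀ n, D.coeff n = 0 := by
    intro n
    induction n with
    | zero =>
      rw [hD, map_sub, PowerSeries.coeff_mul, Finset.Nat.antidiagonal_zero, Finset.sum_singleton, map_sub, PowerSeries.coeff_rescale]
      simp [PowerSeries.sin]
    | succ n ih =>
      have := congrArg (PowerSeries.coeff n) h3
      rw [PowerSeries.coeff_derivative, PowerSeries.coeff_C_mul, ih, mul_zero] at this
      have hn1 : (n : ℂ) + 1 ≠ 0 := by exact_mod_cast Nat.succ_ne_zero n
      exact (mul_eq_zero.mp this).resolve_right hn1
  have h5 : D = 0 := by ext n; simp [h4]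
  exact sub_eq_zero.mp h5

end Stmt16Aux

namespace Stmt16Aux

lemma beta_real (s : ℝ) (h0 : 0 < s) (h1 : s < 1) :
    MeasureTheory.IntegrableOn (fun p : ℝ => p ^ (s - 1) * (1 - p) ^ (-s)) (Set.Ioo 0 1) ∧
    ∫ p in Set.Ioo (0 : ℝ) 1, p ^ (s - 1) * (1 - p) ^ (-s) = Real.pi / Real.sin (Real.pi * s) := by
  have hc := Complex.betaIntegral_convergent (u := (s : ℂ)) (v := ((1 - s : ℝ) : ℂ))
    (by simpa using h0) (by rw [Complex.ofReal_re]; linarith)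
  rw [intervalIntegrable_iff_integrableOn_Ioo_of_le zero_le_one] at hc
  have he : Set.EqOn (fun x : ℝ => (x : ℂ) ^ ((s : ℂ) - 1) *
      (1 - (x : ℂ)) ^ (((1 - s : ℝ) : ℂ) - 1))
      (fun p : ℝ => ((p ^ (s - 1) * (1 - p) ^ (-s) : ℝ) : ℂ)) (Set.Ioo 0 1) := by
    intro p hp
    simp only
    rw [Complex.ofReal_mul, Complex.ofReal_cpow hp.1.le, Complex.ofReal_cpow (by linarith [hp.2])]
    push_cast
    congr 2
    ring
  have hi : MeasureTheory.IntegrableOn (fun p : ℝ => p ^ (s - 1) * (1 - p) ^ (-s))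
      (Set.Ioo 0 1) := by
    have := (hc.congr_fun he measurableSet_Ioo).re
    simpa [MeasureTheory.IntegrableOn] using this
  refine ⟨hi, ?_⟩
  have hb := Complex.betaIntegral_eq_Gamma_mul_div (s : ℂ) ((1 - s : ℝ) : ℂ)
    (by simpa using h0) (by rw [Complex.ofReal_re]; linarith)
  rw [Complex.betaIntegral, intervalIntegral.integral_of_le zero_le_one,
    MeasureTheory.integral_Ioc_eq_integral_Ioo,
    MeasureTheory.setIntegral_congr_fun measurableSet_Ioo he, integral_complex_ofReal,
    Complex.ofReal_sub, Complex.ofReal_one, Complex.Gamma_mul_Gamma_one_sub] at hb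
  simp only [add_sub_cancel, Complex.Gamma_one, div_one] at hb
  exact_mod_cast hb

lemma kernel_one (s : ℝ) (h0 : 0 < s) (h1 : s < 1) :
    MeasureTheory.IntegrableOn (fun t : ℝ => t ^ (s - 1) / (t + 1)) (Set.Ioi 0) ∧
    ∫ t in Set.Ioi (0 : ℝ), t ^ (s - 1) / (t + 1) = Real.pi / Real.sin (Real.pi * s) := by
  obtain ⟨hi, hv⟩ := beta_real s h0 h1
  have himg : (fun t : ℝ => t / (t + 1)) '' Set.Ioi 0 = Set.Ioo 0 1 := by
    ext p
    simp only [Set.mem_image, Set.mem_Ioi, Set.mem_Ioo]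
    constructor
    · rintro ⟨t, ht, rfl⟩
      refine ⟨by positivity, ?_⟩
      rw [div_lt_one (by positivity)]
      linarith
    · rintro ⟨hp0, hp1⟩
      have : 0 < 1 - p := by linarith
      refine ⟨p / (1 - p), by positivity, ?_⟩
      field_simp
      ring
  have hder : ∀ t ∈ Set.Ioi (0:ℝ), HasDerivWithinAt (fun t : ℝ => t / (t + 1))
      (1 / (t + 1) ^ 2) (Set.Ioi 0) t := by
    intro t ht
    have ht' : (0:ℝ) < t := ht
    have := ((hasDerivAt_id t).div ((hasDerivAt_id t).add_const 1) (by simp; positivity))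
    refine this.hasDerivWithinAt.congr_deriv ?_
    simp
  have hinj : Set.InjOn (fun t : ℝ => t / (t + 1)) (Set.Ioi 0) := by
    intro a ha b hb hab
    have ha' : (0:ℝ) < a := ha
    have hb' : (0:ℝ) < b := hb
    change a / (a + 1) = b / (b + 1) at hab
    rw [div_eq_div_iff (by positivity) (by positivity)] at hab
    linarith
  have he : Set.EqOn (fun t : ℝ => |1 / (t + 1) ^ 2| •
      ((t / (t + 1)) ^ (s - 1) * (1 - t / (t + 1)) ^ (-s)))
      (fun t : ℝ => t ^ (s - 1) / (t + 1)) (Set.Ioi 0) := by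
    intro t ht
    have ht' : (0:ℝ) < t := ht
    have ht1 : (0:ℝ) < t + 1 := by linarith
    simp only [smul_eq_mul]
    rw [abs_of_pos (by positivity), show 1 - t / (t + 1) = (t + 1)⁻¹ by field_simp; ring,
      Real.div_rpow ht'.le ht1.le, Real.inv_rpow ht1.le, Real.rpow_neg ht1.le, inv_inv,
      Real.rpow_sub_one ht1.ne']
    have := Real.rpow_pos_of_pos ht1 s
    field_simp
  constructor
  · rw [← himg, MeasureTheory.integrableOn_image_iff_integrableOn_abs_deriv_smul
      measurableSet_Ioi hder hinj] at hi
    exact hi.congr_fun he measurableSet_Ioi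
  · rw [← himg, MeasureTheory.integral_image_eq_integral_abs_deriv_smul
      measurableSet_Ioi hder hinj, MeasureTheory.setIntegral_congr_fun measurableSet_Ioi he] at hv
    exact hv

lemma kernel (s a : ℝ) (h0 : 0 < s) (h1 : s < 1) (ha : 0 < a) :
    MeasureTheory.IntegrableOn (fun t : ℝ => t ^ (s - 1) / (t + a)) (Set.Ioi 0) ∧
    ∫ t in Set.Ioi (0 : ℝ), t ^ (s - 1) / (t + a) =
      a ^ (s - 1) * (Real.pi / Real.sin (Real.pi * s)) := by
  obtain ⟨hi, hv⟩ := kernel_one s h0 h1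
  have ha' : 0 < a⁻¹ := by positivity
  have he : Set.EqOn (fun t : ℝ => a ^ (s - 1) * a⁻¹ * ((a⁻¹ * t) ^ (s - 1) / (a⁻¹ * t + 1)))
      (fun t : ℝ => t ^ (s - 1) / (t + a)) (Set.Ioi 0) := by
    intro t ht
    have ht' : (0:ℝ) < t := ht
    simp only
    rw [Real.mul_rpow ha'.le ht'.le, Real.inv_rpow ha.le]
    have := Real.rpow_pos_of_pos ha (s - 1)
    field_simp
  constructor
  · have := (MeasureTheory.integrableOn_Ioi_comp_mul_left_iff
      (fun t : ℝ => t ^ (s - 1) / (t + 1)) 0 ha').mpr (by simpa using hi)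
    exact MeasureTheory.IntegrableOn.congr_fun (this.const_mul (a ^ (s - 1) * a⁻¹)) he
      measurableSet_Ioi
  · rw [← MeasureTheory.setIntegral_congr_fun measurableSet_Ioi he,
      MeasureTheory.integral_const_mul, MeasureTheory.integral_comp_mul_left_Ioi
      (fun t : ℝ => t ^ (s - 1) / (t + 1)) 0 ha', mul_zero, hv]
    simp only [inv_inv, smul_eq_mul]
    field_simp

/-- The density. -/
noncomputable def dens (a t : ℝ) : ℝ := (1 - a) / ((t + 1) * (t + a))

noncomputable def mu (a : ℝ) : MeasureTheory.Measure ℝ :=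
  (MeasureTheory.volume.restrict (Set.Ioi 0)).withDensity (fun t => ENNReal.ofReal (dens a t))

lemma measurable_dens (a : ℝ) : Measurable (dens a) := by
  unfold dens; fun_prop

lemma dens_nonneg (a : ℝ) (ha : 0 < a) (ha1 : a < 1) (t : ℝ) (ht : 0 < t) : 0 ≤ dens a t := by
  unfold dens
  have : 0 < 1 - a := by linarith
  positivity

lemma integrable_mu (a : ℝ) (ha : 0 < a) (ha1 : a < 1) (f : ℝ → ℝ) :
    MeasureTheory.Integrable f (mu a) ↔
      MeasureTheory.IntegrableOn (fun t => dens a t * f t) (Set.Ioi 0) := by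
  unfold mu
  rw [MeasureTheory.integrable_withDensity_iff_integrable_smul'
    (measurable_dens a).ennreal_ofReal (by simp)]
  refine MeasureTheory.integrableOn_congr_fun (s := Set.Ioi (0:ℝ)) ?_ measurableSet_Ioi
  intro t ht
  simp only [smul_eq_mul]
  rw [ENNReal.toReal_ofReal (dens_nonneg a ha ha1 t ht)]

lemma integral_mu (a : ℝ) (ha : 0 < a) (ha1 : a < 1) (f : ℝ → ℝ) :
    ∫ t, f t ∂(mu a) = ∫ t in Set.Ioi 0, dens a t * f t := by
  unfold mu
  rw [integral_withDensity_eq_integral_toReal_smul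
    (measurable_dens a).ennreal_ofReal (by simp)]
  refine MeasureTheory.setIntegral_congr_fun measurableSet_Ioi ?_
  intro t ht
  simp only [smul_eq_mul]
  rw [ENNReal.toReal_ofReal (dens_nonneg a ha ha1 t ht)]

lemma mgf_neg (a : ℝ) (ha : 0 < a) (ha1 : a < 1) (x : ℝ) (hx : -1 < x) (hx0 : x < 0) :
    x ∈ ProbabilityTheory.integrableExpSet Real.log (mu a) ∧
    ProbabilityTheory.mgf Real.log (mu a) x * Real.sin (Real.pi * x) =
      Real.pi * (1 - a ^ x) := by
  obtain ⟨i1, v1⟩ := kernel (x + 1) a (by linarith) (by linarith) ha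
  obtain ⟨i2, v2⟩ := kernel_one (x + 1) (by linarith) (by linarith)
  simp only [add_sub_cancel_right] at i1 v1 i2 v2
  have he : Set.EqOn (fun t : ℝ => t ^ x / (t + a) - t ^ x / (t + 1))
      (fun t : ℝ => dens a t * Real.exp (x * Real.log t)) (Set.Ioi 0) := by
    intro t ht
    have ht' : (0:ℝ) < t := ht
    simp only [dens]
    rw [mul_comm x, ← Real.rpow_def_of_pos ht']
    field_simp
    ring
  constructor
  · rw [ProbabilityTheory.integrableExpSet, Set.mem_ofPred_eq, integrable_mu a ha ha1]
    exact MeasureTheory.IntegrableOn.congr_fun (i1.sub i2) he measurableSet_Ioi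
  · rw [ProbabilityTheory.mgf, integral_mu a ha ha1,
      ← MeasureTheory.setIntegral_congr_fun measurableSet_Ioi he,
      MeasureTheory.integral_sub i1 i2, v1, v2, mul_add, mul_one, Real.sin_add_pi]
    have : Real.sin (Real.pi * x) ≠ 0 := by
      apply ne_of_lt
      apply Real.sin_neg_of_neg_of_neg_pi_lt
      · nlinarith [Real.pi_pos]
      · nlinarith [Real.pi_pos]
    field_simp
    ring

lemma mem_half (a : ℝ) (ha : 0 < a) (ha1 : a < 1) :
    (1/2 : ℝ) ∈ ProbabilityTheory.integrableExpSet Real.log (mu a) := by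
  obtain ⟨i2, v2⟩ := kernel_one (1/2) (by norm_num) (by norm_num)
  rw [ProbabilityTheory.integrableExpSet, Set.mem_ofPred_eq, integrable_mu a ha ha1]
  refine MeasureTheory.Integrable.mono' (i2.const_mul (1 - a)) ?_ ?_
  · have := measurable_dens a
    exact Measurable.aestronglyMeasurable (by fun_prop)
  · refine (MeasureTheory.ae_restrict_iff' measurableSet_Ioi).mpr (Filter.Eventually.of_forall ?_)
    intro t ht
    have ht' : (0:ℝ) < t := ht
    have h1a : 0 < 1 - a := by linarith
    rw [Real.norm_of_nonneg (mul_nonneg (dens_nonneg a ha ha1 t ht) (Real.exp_pos _).le), mul_comm (1/2 : ℝ),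
      ← Real.rpow_def_of_pos ht', Real.rpow_sub_one ht'.ne']
    unfold dens
    have hp := Real.rpow_pos_of_pos ht' (1/2)
    rw [div_mul_eq_mul_div, ← mul_div_assoc, ← mul_div_assoc, div_div, mul_comm (t + 1)]
    gcongr
    linarith

lemma zero_mem (a : ℝ) (ha : 0 < a) (ha1 : a < 1) :
    (0 : ℝ) ∈ interior (ProbabilityTheory.integrableExpSet Real.log (mu a)) := by
  have h1 := (mgf_neg a ha ha1 (-1/2) (by norm_num) (by norm_num)).1
  have h2 := mem_half a ha ha1
  have h3 := (ProbabilityTheory.convex_integrableExpSet (X := Real.log) (μ := mu a)).ordConnected.out h1 h2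
  rw [mem_interior_iff_mem_nhds]
  exact Filter.mem_of_superset (Icc_mem_nhds (by norm_num) (by norm_num)) h3

lemma mgf_eventually (a : ℝ) (ha : 0 < a) (ha1 : a < 1) :
    (ProbabilityTheory.mgf Real.log (mu a) * fun x => Real.sin (Real.pi * x)) =ᶠ[nhds 0]
      fun x => Real.pi * (1 - Real.exp (Real.log a * x)) := by
  have hA := ProbabilityTheory.analyticAt_mgf (zero_mem a ha ha1)
  have hs : AnalyticAt ℝ (fun x => Real.sin (Real.pi * x)) 0 := by fun_prop
  have hr : AnalyticAt ℝ (fun x => Real.pi * (1 - Real.exp (Real.log a * x))) 0 := by fun_prop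
  refine ((hA.mul hs).frequently_eq_iff_eventually_eq hr).mp ?_
  have h1 : ∀ᶠ x in nhdsWithin (0:ℝ) (Set.Iio 0), (ProbabilityTheory.mgf Real.log (mu a) * fun x => Real.sin (Real.pi * x)) x = Real.pi * (1 - Real.exp (Real.log a * x)) := by
    filter_upwards [Ioo_mem_nhdsLT (show (-1:ℝ) < 0 by norm_num)] with x hx
    rw [← Real.rpow_def_of_pos ha]
    exact (mgf_neg a ha ha1 x hx.1 hx.2).2
  exact h1.frequently.filter_mono (nhdsWithin_mono _ (fun x hx => ne_of_lt hx))

lemma iteratedDeriv_sin_zero (n : ℕ) :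
    iteratedDeriv n Real.sin 0 = n.factorial * PowerSeries.coeff n (PowerSeries.sin ℝ) := by
  induction n using Nat.twoStepInduction with
  | zero => simp [PowerSeries.sin]
  | one => simp [PowerSeries.sin]
  | more n ih _ =>
    have h : iteratedDeriv (n + 2) Real.sin 0 = - iteratedDeriv n Real.sin 0 := by simp
    have h2 := congrArg (PowerSeries.coeff n) (congrArg (PowerSeries.derivative ℝ) (deriv_sin ℝ))
    rw [deriv_cos, PowerSeries.coeff_derivative, PowerSeries.coeff_derivative, map_neg] at h2
    rw [h, ih, Nat.factorial_succ, Nat.factorial_succ]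
    push_cast at h2 ⊢
    linear_combination - (n.factorial : ℝ) * h2

lemma F_egf (z : ℝ) (hz : z < 0) :
    PowerSeries.sin ℂ * (PowerSeries.mk fun n =>
      (-(((1 - Real.exp z) *
        ∫ t in Set.Ioi (0 : ℝ), (Real.log t) ^ n / ((t + 1) * (t + Real.exp z)) : ℝ) : ℂ) /
          (Real.pi : ℂ) ^ (n + 1)) / (n.factorial : ℂ)) =
      PowerSeries.rescale ((z : ℂ) / (Real.pi : ℂ)) (PowerSeries.exp ℂ) - 1 := by
  have ha := Real.exp_pos z
  have ha1 : Real.exp z < 1 := by simpa using hz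
  have h0 := zero_mem _ ha ha1
  have hev := mgf_eventually _ ha ha1
  have hF : ∀ n, iteratedDeriv n (ProbabilityTheory.mgf Real.log (mu (Real.exp z))) 0 =
      (1 - Real.exp z) *
        ∫ t in Set.Ioi (0 : ℝ), (Real.log t) ^ n / ((t + 1) * (t + Real.exp z)) := by
    intro n
    rw [ProbabilityTheory.iteratedDeriv_mgf_zero h0, integral_mu _ ha ha1,
      ← MeasureTheory.integral_const_mul]
    congr 1
    ext t
    simp only [dens, Pi.pow_apply]
    ring
  simp only [← hF]
  set f := ProbabilityTheory.mgf Real.log (mu (Real.exp z)) with hf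
  have hA : AnalyticAt ℝ f 0 := ProbabilityTheory.analyticAt_mgf h0
  have hpi : (Real.pi : ℂ) ≠ 0 := by exact_mod_cast Real.pi_ne_zero
  ext n
  have h1 := hev.iteratedDeriv_eq n
  have hs : AnalyticAt ℝ (fun x => Real.sin (Real.pi * x)) 0 := by fun_prop
  rw [iteratedDeriv_mul hA.contDiffAt hs.contDiffAt] at h1
  have hsin : ∀ m, iteratedDeriv m (fun x => Real.sin (Real.pi * x)) 0 =
      Real.pi ^ m * (m.factorial * PowerSeries.coeff m (PowerSeries.sin ℝ)) := by
    intro m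
    rw [iteratedDeriv_comp_const_mul Real.contDiff_sin]
    simp [iteratedDeriv_sin_zero]
  have hrhs : iteratedDeriv n (fun x => Real.pi * (1 - Real.exp (Real.log (Real.exp z) * x))) 0 =
      Real.pi * ((if n = 0 then 1 else 0) - z ^ n) := by
    rw [Real.log_exp, iteratedDeriv_const_mul_field,
      iteratedDeriv_fun_sub (by fun_prop) (by fun_prop), iteratedDeriv_exp_const_mul]
    simp [iteratedDeriv_const]
  rw [hrhs] at h1
  simp only [hsin] at h1
  have hsc : ∀ m, PowerSeries.coeff m (PowerSeries.sin ℂ) =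
      ((PowerSeries.coeff m (PowerSeries.sin ℝ) : ℝ) : ℂ) := by
    intro m
    rw [← PowerSeries.map_sin (Complex.ofRealHom), PowerSeries.coeff_map]
    rfl
  rw [mul_comm, PowerSeries.coeff_mul, Finset.Nat.sum_antidiagonal_eq_sum_range_succ_mk, map_sub,
    PowerSeries.coeff_rescale, PowerSeries.coeff_exp, PowerSeries.coeff_one]
  simp only [PowerSeries.coeff_mk, hsc]
  have h2 := congrArg (fun r : ℝ => (r : ℂ)) h1
  have hfn : (n.factorial : ℂ) ≠ 0 := by exact_mod_cast n.factorial_ne_zero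
  have h3 : ∑ k ∈ Finset.range n.succ, -((iteratedDeriv k f 0 : ℝ) : ℂ) / (Real.pi : ℂ) ^ (k + 1) /
      (k.factorial : ℂ) * ((PowerSeries.coeff (n - k) (PowerSeries.sin ℝ) : ℝ) : ℂ) =
      -(1 / ((Real.pi : ℂ) ^ (n + 1) * n.factorial)) * ((∑ i ∈ Finset.range (n + 1),
        n.choose i * iteratedDeriv i f 0 * (Real.pi ^ (n - i) * ((n - i).factorial *
          PowerSeries.coeff (n - i) (PowerSeries.sin ℝ))) : ℝ) : ℂ) := by
    rw [Complex.ofReal_sum, Finset.mul_sum]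
    refine Finset.sum_congr rfl fun k hk => ?_
    have hk' : k ≤ n := by have := Finset.mem_range.mp hk; omega
    have hfk : (k.factorial : ℂ) ≠ 0 := by exact_mod_cast k.factorial_ne_zero
    have hfnk : ((n - k).factorial : ℂ) ≠ 0 := by exact_mod_cast (n - k).factorial_ne_zero
    push_cast
    rw [Nat.cast_choose ℂ hk']
    have hpw : (Real.pi : ℂ) ^ (n + 1) = (Real.pi : ℂ) ^ (k + 1) * (Real.pi : ℂ) ^ (n - k) := by
      rw [← pow_add]; congr 1; omega
    rw [hpw]
    field_simp
  rw [h3, h1]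
  push_cast
  rw [div_pow]
  rcases n with _ | n
  · simp
  · simp only [Nat.succ_ne_zero, if_false]
    simp
    field_simp
    ring

end Stmt16Aux

theorem stmt16 (n : ℕ) (z : ℝ) (hz : z < 0) :
    (((1 - Real.exp z) *
        ∫ t in Set.Ioi (0 : ℝ), (Real.log t) ^ n / ((t + 1) * (t + Real.exp z)) : ℝ) : ℂ) =
      -(Real.pi : ℂ) ^ (n + 1) * (polyA n).eval ((z : ℂ) / (Real.pi : ℂ)) := by
  have h := (Stmt16Aux.F_egf z hz).trans (Stmt16Aux.A_egf ((z : ℂ) / (Real.pi : ℂ))).symm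
  have hs : PowerSeries.sin ℂ ≠ 0 := by
    intro h
    have := congrArg (PowerSeries.coeff 1) h
    simp [PowerSeries.sin] at this
  have h' := congrArg (PowerSeries.coeff n) (mul_left_cancel₀ hs h)
  rw [PowerSeries.coeff_mk, PowerSeries.coeff_mk] at h'
  have hfn : (n.factorial : ℂ) ≠ 0 := by exact_mod_cast n.factorial_ne_zero
  have hpi : (Real.pi : ℂ) ≠ 0 := by exact_mod_cast Real.pi_ne_zero
  rw [div_left_inj' hfn, div_eq_iff (pow_ne_zero _ hpi)] at h'
  linear_combination -h'
end

section
/- Let T be the operator on real-valued functions of a real variable defined by T(f)(x) = ∫_{0}^{1} (f(t) − f(x))/(t − x) dt, and let φ₀(x) = ln(x/(1−x)). Then for every natural number n ≥ 1, ∫_{0}^{1} T^{[2n−1]}(φ₀)(x) dx = (−1)^{n+1}·4ⁿ·β_{2n}·π^{2n}, where T^{[2n−1]} denotes the (2n−1)-fold iterate of T and all integrals are taken over the open interval (0,1). -/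
open MeasureTheory Real

/-- The finite Hilbert-type transform on `(0,1)`:
`T f x = ∫ t in (0,1), (f t - f x) / (t - x)`. -/
noncomputable def T (f : ℝ → ℝ) : ℝ → ℝ :=
  fun x => ∫ t in Set.Ioo (0 : ℝ) 1, (f t - f x) / (t - x)

open PowerSeries in
noncomputable def dC : PowerSeries ℂ :=
  rescale (2 * π * Complex.I) (bernoulliPowerSeries ℂ) + C (Complex.I * π) * X

noncomputable def dd (n : ℕ) : ℝ :=
  if Even n then (-1) ^ (n / 2) * (2 * π) ^ n * ((bernoulli n : ℚ) : ℝ) / (n.factorial : ℝ) else 0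

noncomputable def cc (n : ℕ) : ℝ := (2 * (1 / 2) ^ n - 1) * dd n

lemma coeff_dC (n : ℕ) : PowerSeries.coeff n dC = (dd n : ℂ) := by
  unfold dC dd
  simp only [map_add, PowerSeries.coeff_rescale, bernoulliPowerSeries, PowerSeries.coeff_mk,
    PowerSeries.coeff_C_mul, PowerSeries.coeff_X]
  rcases Nat.even_or_odd n with h | h
  · obtain ⟨m, rfl⟩ := h
    have h1 : m + m ≠ 1 := by omega
    have h2 : (m + m) / 2 = m := by omega
    have h3 : (2 * (π : ℂ) * Complex.I) ^ (m + m) = (2 * π) ^ (m + m) * (-1) ^ m := by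
      rw [mul_pow, ← two_mul, pow_mul Complex.I, Complex.I_sq]
    simp [h1, h2, h3]
    ring
  · have h0 : ¬ Even n := Nat.not_even_iff_odd.mpr h
    by_cases h1 : n = 1
    · subst h1
      simp
      ring
    · have : bernoulli n = 0 := bernoulli_eq_zero_of_odd h (by rcases h with ⟨k, rfl⟩; omega)
      simp [h0, h1, this]

open PowerSeries in
noncomputable def cC : PowerSeries ℂ := 2 * rescale (1/2 : ℂ) dC - dC

lemma coeff_cC (n : ℕ) : PowerSeries.coeff n cC = (cc n : ℂ) := by
  have : (2 : PowerSeries ℂ) = PowerSeries.C (2 : ℂ) := (map_ofNat PowerSeries.C 2).symm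
  rw [cC, map_sub, this, PowerSeries.coeff_C_mul, PowerSeries.coeff_rescale, coeff_dC, cc]
  push_cast
  ring

section alg
open PowerSeries

lemma rescale_exp_sq (a : ℂ) : rescale (2 * a) (exp ℂ) = (rescale a (exp ℂ)) ^ 2 := by
  rw [← map_pow, exp_pow_eq_rescale_exp, rescale_rescale]
  norm_num [mul_comm]

lemma deriv_rescale_exp (a : ℂ) :
    PowerSeries.derivative ℂ (rescale a (exp ℂ)) = C a * rescale a (exp ℂ) := by
  ext n
  simp [coeff_derivative, coeff_rescale, coeff_exp, coeff_C_mul, Nat.factorial_succ]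
  have : (n : ℂ) + 1 ≠ 0 := by exact_mod_cast Nat.succ_ne_zero n
  field_simp
  ring

noncomputable def hh : PowerSeries ℂ := rescale (π * Complex.I) (exp ℂ)

lemma hh_deriv : PowerSeries.derivative ℂ hh = C (π * Complex.I) * hh := deriv_rescale_exp _

lemma dC_eq : dC * (hh ^ 2 - 1) = C (π * Complex.I) * X * (hh ^ 2 + 1) := by
  have := congrArg (rescale (2 * π * Complex.I)) (bernoulliPowerSeries_mul_exp_sub_one ℂ)
  rw [map_mul, map_sub, map_one, rescale_X, mul_assoc 2, rescale_exp_sq, ← hh] at this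
  have h2 : (C (2 * (π * Complex.I)) : PowerSeries ℂ) = 2 * C (π * Complex.I) := by
    rw [map_mul, map_ofNat]
  rw [h2] at this
  rw [dC, mul_comm Complex.I, mul_assoc 2]
  linear_combination this

lemma dC_half_eq : (2 * rescale (1/2 : ℂ) dC) * (hh - 1) = C (π * Complex.I) * X * (hh + 1) := by
  have := congrArg (rescale (1/2 : ℂ)) dC_eq
  simp only [map_mul, map_sub, map_one, map_add, rescale_X] at this
  have h1 : rescale (1/2 : ℂ) (hh ^ 2) = hh := by
    rw [hh, ← rescale_exp_sq, rescale_rescale]; congr 2; ring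
  have h2 : ∀ a : ℂ, rescale (1/2 : ℂ) (C a) = C a := by
    intro a; ext n; rw [coeff_rescale, coeff_C]; split_ifs with h <;> simp [h]
  have h3 : (2 * C (1/2 : ℂ) : PowerSeries ℂ) = 1 := by
    rw [show (2 : PowerSeries ℂ) = C (2 : ℂ) from (map_ofNat C 2).symm, ← map_mul]; norm_num
  rw [h1] at this
  simp only [← map_mul, h2] at this
  simp only [map_mul] at this ⊢
  linear_combination 2 * this + (C (π : ℂ) * C Complex.I * X * (hh + 1)) * h3

lemma cC_eq : cC * (hh ^ 2 - 1) = 2 * C (π * Complex.I) * X * hh := by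
  rw [cC]
  linear_combination (hh + 1) * dC_half_eq - dC_eq

lemma hh_ne : hh ^ 2 - 1 ≠ 0 := by
  intro h
  have := dC_eq
  have h1 : hh ^ 2 = 1 := by linear_combination h
  rw [h, h1, mul_zero] at this
  have h2 := congrArg (coeff 1) this
  rw [mul_comm _ X, mul_assoc, coeff_succ_X_mul] at h2
  simp at h2

lemma cd_eq : cC * dC = cC - X * PowerSeries.derivative ℂ cC := by
  have h1 := congrArg (PowerSeries.derivative ℂ) cC_eq
  have h2 := hh_deriv
  have hX : PowerSeries.derivative ℂ (X : PowerSeries ℂ) = 1 := derivative_X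
  have hC : PowerSeries.derivative ℂ (C (π * Complex.I)) = 0 := derivative_C
  have h2' : PowerSeries.derivative ℂ (2 : PowerSeries ℂ) = 0 := by
    rw [show (2 : PowerSeries ℂ) = C (2 : ℂ) from (map_ofNat C 2).symm]; exact derivative_C
  simp only [Derivation.leibniz, map_sub, Derivation.leibniz_pow, h2, hX, hC, h2', smul_eq_mul,
    Derivation.map_one_eq_zero, nsmul_eq_mul] at h1
  have := hh_ne
  have h3 := cC_eq
  have h4 := dC_eq
  generalize C (π * Complex.I) = p at *
  generalize PowerSeries.derivative ℂ cC = c' at *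
  push_cast at h1
  apply mul_right_cancel₀ this
  apply mul_right_cancel₀ this
  linear_combination (hh^2-1) * X * h1 + (dC * (hh^2-1) - (hh^2-1) - 2 * p * X * hh^2) * h3 + 2 * p * X * hh * h4

lemma cc_eq : cC * cC = dC - X * PowerSeries.derivative ℂ dC := by
  have h1 := congrArg (PowerSeries.derivative ℂ) dC_eq
  have h2 := hh_deriv
  have hX : PowerSeries.derivative ℂ (X : PowerSeries ℂ) = 1 := derivative_X
  have hC : PowerSeries.derivative ℂ (C (π * Complex.I)) = 0 := derivative_C
  simp only [Derivation.leibniz, map_sub, map_add, Derivation.leibniz_pow, h2, hX, hC, smul_eq_mul,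
    Derivation.map_one_eq_zero, nsmul_eq_mul] at h1
  have := hh_ne
  have h3 := cC_eq
  have h4 := dC_eq
  generalize C (π * Complex.I) = p at *
  generalize PowerSeries.derivative ℂ dC = c' at *
  push_cast at h1
  apply mul_right_cancel₀ this
  apply mul_right_cancel₀ this
  linear_combination (hh^2-1) * X * h1 + (cC * (hh^2-1) + 2 * p * X * hh) * h3 + (- (hh^2-1) - 2 * p * X * hh^2) * h4

end alg

lemma conv_cd (N : ℕ) : ∑ x ∈ Finset.HasAntidiagonal.antidiagonal N, cc x.1 * dd x.2 = (1 - N) * cc N := by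
  have := congrArg (PowerSeries.coeff N) cd_eq
  rw [PowerSeries.coeff_mul] at this
  simp only [coeff_cC, coeff_dC, map_sub] at this
  have h : PowerSeries.coeff N (PowerSeries.X * PowerSeries.derivative ℂ cC) = N * (cc N : ℂ) := by
    cases N with
    | zero => simp
    | succ n => rw [PowerSeries.coeff_succ_X_mul, PowerSeries.coeff_derivative, coeff_cC]; push_cast; ring
  rw [h] at this
  have : ∑ x ∈ Finset.HasAntidiagonal.antidiagonal N, cc x.1 * dd x.2 = cc N - N * cc N := by exact_mod_cast this
  rw [this]; ring

lemma conv_cc (N : ℕ) : ∑ x ∈ Finset.HasAntidiagonal.antidiagonal N, cc x.1 * cc x.2 = (1 - N) * dd N := by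
  have := congrArg (PowerSeries.coeff N) cc_eq
  rw [PowerSeries.coeff_mul] at this
  simp only [coeff_cC, coeff_dC, map_sub] at this
  have h : PowerSeries.coeff N (PowerSeries.X * PowerSeries.derivative ℂ dC) = N * (dd N : ℂ) := by
    cases N with
    | zero => simp
    | succ n => rw [PowerSeries.coeff_succ_X_mul, PowerSeries.coeff_derivative, coeff_dC]; push_cast; ring
  rw [h] at this
  have : ∑ x ∈ Finset.HasAntidiagonal.antidiagonal N, cc x.1 * cc x.2 = dd N - N * dd N := by exact_mod_cast this
  rw [this]; ring

lemma dd_zero : dd 0 = 1 := by simp [dd]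
lemma cc_zero : cc 0 = 1 := by simp [cc, dd_zero]; norm_num
lemma dd_odd {n : ℕ} (h : Odd n) : dd n = 0 := by simp [dd, Nat.not_even_iff_odd.mpr h]
lemma cc_odd {n : ℕ} (h : Odd n) : cc n = 0 := by simp [cc, dd_odd h]


/-- `f` is integrable with integral `a`. -/
def HI (μ : Measure ℝ) (f : ℝ → ℝ) (a : ℝ) : Prop := Integrable f μ ∧ ∫ x, f x ∂μ = a

lemma HI.add {μ : Measure ℝ} {f g : ℝ → ℝ} {a b : ℝ} (hf : HI μ f a) (hg : HI μ g b) :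
    HI μ (fun x => f x + g x) (a + b) :=
  ⟨hf.1.add hg.1, by rw [integral_add hf.1 hg.1, hf.2, hg.2]⟩

lemma HI.sub {μ : Measure ℝ} {f g : ℝ → ℝ} {a b : ℝ} (hf : HI μ f a) (hg : HI μ g b) :
    HI μ (fun x => f x - g x) (a - b) :=
  ⟨hf.1.sub hg.1, by rw [integral_sub hf.1 hg.1, hf.2, hg.2]⟩

lemma HI.const_mul {μ : Measure ℝ} {f : ℝ → ℝ} {a : ℝ} (hf : HI μ f a) (c : ℝ) :
    HI μ (fun x => c * f x) (c * a) :=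
  ⟨hf.1.const_mul c, by rw [integral_const_mul, hf.2]⟩

lemma HI.sum {μ : Measure ℝ} {s : Finset ℕ} {f : ℕ → ℝ → ℝ} {a : ℕ → ℝ}
    (h : ∀ i ∈ s, HI μ (f i) (a i)) : HI μ (fun x => ∑ i ∈ s, f i x) (∑ i ∈ s, a i) :=
  ⟨integrable_finsetSum s fun i hi => (h i hi).1, by
    rw [integral_finsetSum s fun i hi => (h i hi).1]
    exact Finset.sum_congr rfl fun i hi => (h i hi).2⟩

lemma HI.congr_Ioi {f g : ℝ → ℝ} {a : ℝ} (hf : HI (volume.restrict (Set.Ioi 0)) f a)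
    (h : ∀ x, 0 < x → f x = g x) : HI (volume.restrict (Set.Ioi 0)) g a := by
  refine ⟨IntegrableOn.congr_fun hf.1 (fun x hx => h x hx) measurableSet_Ioi, ?_⟩
  rw [← hf.2]
  exact (setIntegral_congr_fun measurableSet_Ioi (fun x hx => h x hx)).symm

lemma HI.sym {f g : ℝ → ℝ} {a : ℝ} (e : ℝ) (hf : HI (volume.restrict (Set.Ioi 0)) f a)
    (h1 : ∀ x, 0 < x → g x = f x) (h2 : ∀ x, 0 < x → g (-x) = e * f x) :
    HI volume g ((1 + e) * a) := by
  have A : HI (volume.restrict (Set.Ioi 0)) g a := hf.congr_Ioi fun x hx => (h1 x hx).symm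
  have B : HI (volume.restrict (Set.Ioi 0)) (fun x => g (-x)) (e * a) :=
    (hf.const_mul e).congr_Ioi fun x hx => (h2 x hx).symm
  have C : IntegrableOn g (Set.Iic 0) := by
    rw [integrableOn_Iic_iff_integrableOn_Iio]
    have : IntegrableOn (fun x => g (-x)) (Set.Ioi (-0)) := by rw [neg_zero]; exact B.1
    simpa using this.comp_neg_Iio
  constructor
  · rw [← integrableOn_univ, ← Set.Iic_union_Ioi (a := (0:ℝ))]
    exact C.union A.1
  · rw [← intervalIntegral.integral_Iic_add_Ioi C A.1, A.2]
    have := integral_comp_neg_Ioi 0 g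
    rw [neg_zero] at this
    rw [← this, B.2]; ring

lemma HI_gamma (j : ℕ) {r : ℝ} (hr : 0 < r) :
    HI (volume.restrict (Set.Ioi 0)) (fun t => t ^ j * exp (-(r * t)))
      (j.factorial / r ^ (j + 1)) := by
  have key := integral_rpow_mul_exp_neg_mul_Ioi (a := j + 1) (by positivity) hr
  have h : ∫ t in Set.Ioi 0, t ^ j * exp (-(r * t)) = j.factorial / r ^ (j + 1) := by
    rw [Gamma_nat_eq_factorial] at key
    have e : (1 / r) ^ ((j : ℝ) + 1) * (j.factorial : ℝ) = j.factorial / r ^ (j + 1) := by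
      rw [show ((j : ℝ) + 1) = ((j + 1 : ℕ) : ℝ) by push_cast; rfl, rpow_natCast, div_pow, one_pow]
      ring
    rw [← e, ← key]
    simp
  exact ⟨.of_integral_ne_zero (by rw [h]; positivity), h⟩

lemma HI_zeta (j : ℕ) (hj : 1 ≤ j) :
    HI (volume.restrict (Set.Ioi 0)) (fun t => t ^ j / (exp t - 1))
      (j.factorial * ∑' n : ℕ, 1 / ((n : ℝ) + 1) ^ (j + 1)) := by
  have hs : Summable fun n : ℕ => 1 / ((n : ℝ) + 1) ^ (j + 1) := by
    have := (summable_nat_add_iff 1).mpr (Real.summable_one_div_nat_pow.mpr (by omega : 1 < j + 1))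
    simpa using this
  have key := hasSum_integral_of_summable_integral_norm
    (μ := volume.restrict (Set.Ioi 0)) (F := fun (n : ℕ) t => t ^ j * exp (-(((n : ℝ) + 1) * t)))
    (fun n => (HI_gamma j (by positivity)).1) (by
      have : ∀ n : ℕ, ∫ a in Set.Ioi 0, ‖a ^ j * exp (-(((n : ℝ) + 1) * a))‖
          = j.factorial * (1 / ((n : ℝ) + 1) ^ (j + 1)) := by
        intro n
        rw [mul_one_div, ← (HI_gamma j (by positivity : (0:ℝ) < n + 1)).2]
        refine setIntegral_congr_fun measurableSet_Ioi fun x hx => ?_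
        have hx : 0 < x := hx
        rw [Real.norm_of_nonneg (by positivity)]
      simp_rw [this]
      exact hs.mul_left _)
  have h1 : ∫ t in Set.Ioi 0, t ^ j / (exp t - 1)
      = j.factorial * ∑' n : ℕ, 1 / ((n : ℝ) + 1) ^ (j + 1) := by
    rw [← tsum_mul_left]
    have h2 : ∀ n : ℕ, (j.factorial : ℝ) * (1 / ((n : ℝ) + 1) ^ (j + 1)) =
        ∫ t in Set.Ioi 0, t ^ j * exp (-(((n : ℝ) + 1) * t)) := fun n => by
      rw [(HI_gamma j (by positivity : (0:ℝ) < n + 1)).2, mul_one_div]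
    simp_rw [h2]
    rw [key.tsum_eq]
    refine setIntegral_congr_fun measurableSet_Ioi fun x hx => ?_
    have hx : 0 < x := hx
    rw [tsum_mul_left]
    have h3 : ∀ n : ℕ, exp (-(((n : ℝ) + 1) * x)) = exp (-x) * exp (-x) ^ n := fun n => by
      rw [← exp_nat_mul, ← exp_add]; ring_nf
    simp_rw [h3]
    have hlt : exp (-x) < 1 := by rw [exp_lt_one_iff]; linarith
    rw [tsum_mul_left, tsum_geometric_of_lt_one (exp_pos _).le hlt]
    have : exp x - 1 ≠ 0 := by have := Real.add_one_lt_exp hx.ne'; linarith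
    rw [exp_neg] at hlt ⊢
    have h4 := exp_pos x
    have h5 : 1 - (exp x)⁻¹ ≠ 0 := by linarith
    field_simp
  have hpos : 0 < ∑' n : ℕ, 1 / ((n : ℝ) + 1) ^ (j + 1) :=
    hs.tsum_pos (fun n => by positivity) 0 (by positivity)
  exact ⟨.of_integral_ne_zero (by rw [h1]; positivity), h1⟩

lemma zeta_val (j : ℕ) (hj : Odd j) :
    ∑' n : ℕ, 1 / ((n : ℝ) + 1) ^ (j + 1) = - dd (j + 1) / 2 := by
  obtain ⟨m, rfl⟩ := hj
  have h := hasSum_zeta_nat (k := m + 1) (by omega)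
  rw [← hasSum_nat_add_iff' 1] at h
  have h2 := h.tsum_eq
  rw [show 2 * m + 1 + 1 = 2 * (m + 1) by ring]
  push_cast at h2
  rw [h2, dd, if_pos (by simp), show 2 * (m + 1) / 2 = m + 1 by omega,
    show 2 * (m + 1) - 1 = 2 * m + 1 by omega]
  simp
  rw [mul_pow, show 2 * (m + 1) = 2 * m + 1 + 1 by ring]
  ring

/-- first kernel -/
noncomputable def k1 (w : ℝ) : ℝ := 1 / (exp w - 1) + if w < 0 then 1 else 0

/-- second kernel -/
noncomputable def k2 (w : ℝ) : ℝ := 1 / (1 + exp w) - if w < 0 then 1 else 0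

lemma k1_pos {w : ℝ} (h : 0 < w) : k1 w = 1 / (exp w - 1) := by simp [k1, not_lt.mpr h.le]
lemma k1_neg {w : ℝ} (h : 0 < w) : k1 (-w) = -(1 / (exp w - 1)) := by
  have : exp w - 1 ≠ 0 := by have := Real.add_one_lt_exp h.ne'; linarith
  have h4 := exp_pos w
  have h5 : (exp w)⁻¹ - 1 ≠ 0 := by
    intro h6
    apply this
    field_simp at h6
    linarith
  simp only [k1, Left.neg_neg_iff, h, if_true, exp_neg]
  have h7 : 1 - exp w ≠ 0 := by intro h8; apply this; linarith
  field_simp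
  ring
lemma k2_pos {w : ℝ} (h : 0 < w) : k2 w = 1 / (1 + exp w) := by simp [k2, not_lt.mpr h.le]
lemma k2_neg {w : ℝ} (h : 0 < w) : k2 (-w) = -(1 / (1 + exp w)) := by
  have h4 := exp_pos w
  simp only [k2, Left.neg_neg_iff, h, if_true, exp_neg]
  field_simp
  ring

lemma HI_k1 (j : ℕ) (hj : 1 ≤ j) :
    HI volume (fun w => w ^ j * k1 w) (- (j.factorial * dd (j + 1))) := by
  have h := (HI_zeta j hj).sym (g := fun w => w ^ j * k1 w) (-(-1) ^ j)
    (fun x hx => by rw [k1_pos hx]; ring) (fun x hx => by rw [k1_neg hx, neg_pow]; ring)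
  convert h using 1
  rcases Nat.even_or_odd j with h' | h'
  · rw [dd_odd h'.add_one, h'.neg_one_pow]; ring
  · rw [zeta_val j h', h'.neg_one_pow]; ring

lemma HI_eta (j : ℕ) (hj : 1 ≤ j) :
    HI (volume.restrict (Set.Ioi 0)) (fun t => t ^ j / (1 + exp t))
      ((1 - (1 / 2) ^ j) * (j.factorial * ∑' n : ℕ, 1 / ((n : ℝ) + 1) ^ (j + 1))) := by
  have h := HI_zeta j hj
  set Z := (j.factorial * ∑' n : ℕ, 1 / ((n : ℝ) + 1) ^ (j + 1) : ℝ)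
  have h2 : HI (volume.restrict (Set.Ioi 0)) (fun t => (2 * t) ^ j / (exp (2 * t) - 1)) (2⁻¹ * Z) := by
    constructor
    · have := integrableOn_Ioi_comp_mul_left_iff (fun t => t ^ j / (exp t - 1)) 0 (two_pos (α := ℝ))
      rw [mul_zero] at this
      exact this.mpr h.1
    · have := integral_comp_mul_left_Ioi (fun t => t ^ j / (exp t - 1)) 0 (two_pos (α := ℝ))
      rw [mul_zero, h.2] at this
      exact this
  have h3 := h.sub (h2.const_mul (2 * (1 / 2) ^ j))
  have h4 := h3.congr_Ioi (g := fun t => t ^ j / (1 + exp t)) (fun x hx => by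
    have : exp x - 1 ≠ 0 := by have := Real.add_one_lt_exp hx.ne'; linarith
    have h4 := exp_pos x
    have h5 : exp (2 * x) - 1 = (exp x - 1) * (1 + exp x) := by rw [two_mul, exp_add]; ring
    have h6 : (1 / 2 : ℝ) ^ j * 2 ^ j = 1 := by rw [← mul_pow]; norm_num
    rw [h5, mul_pow]
    field_simp
    linear_combination (-2 : ℝ) * h6)
  convert h4 using 1
  ring

lemma HI_eta0 (j : ℕ) :
    Integrable (fun t => t ^ j / (1 + exp t)) (volume.restrict (Set.Ioi 0)) := by
  refine Integrable.mono' (HI_gamma j one_pos).1 ?_ ?_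
  · apply Continuous.aestronglyMeasurable
    refine Continuous.div (by fun_prop) (by fun_prop) fun x => by positivity
  · refine (ae_restrict_iff' measurableSet_Ioi).mpr (ae_of_all _ fun x hx => ?_)
    have hx : 0 < x := hx
    rw [Real.norm_of_nonneg (by positivity), one_mul, exp_neg, div_eq_mul_inv]
    gcongr
    linarith

lemma HI_k2 (j : ℕ) : HI volume (fun w => w ^ j * k2 w) (j.factorial * cc (j + 1)) := by
  rcases Nat.even_or_odd j with h' | h'
  · have h := HI.sym (a := _) (g := fun w => w ^ j * k2 w) (-1) ⟨HI_eta0 j, rfl⟩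
      (fun x hx => by rw [k2_pos hx]; ring)
      (fun x hx => by rw [k2_neg hx, neg_pow, h'.neg_one_pow]; ring)
    convert h using 1
    rw [cc_odd h'.add_one]; ring
  · have h := (HI_eta j h'.pos).sym (g := fun w => w ^ j * k2 w) 1
      (fun x hx => by rw [k2_pos hx]; ring)
      (fun x hx => by rw [k2_neg hx, neg_pow, h'.neg_one_pow]; ring)
    convert h using 1
    rw [zeta_val j h', cc]; ring

/-- moments of the logistic density -/
lemma HI_dens (m : ℕ) :
    HI volume (fun v => v ^ m * (exp v / (1 + exp v) ^ 2)) (m.factorial * cc m) := by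
  have hInt : Integrable (fun t => t ^ m * (exp t / (1 + exp t) ^ 2))
      (volume.restrict (Set.Ioi 0)) := by
    refine Integrable.mono' (HI_eta0 m) ?_ ?_
    · apply Continuous.aestronglyMeasurable
      refine Continuous.mul (by fun_prop) ?_
      refine Continuous.div (by fun_prop) (by fun_prop) fun x => by positivity
    · refine (ae_restrict_iff' measurableSet_Ioi).mpr (ae_of_all _ fun x hx => ?_)
      have hx : 0 < x := hx
      rw [Real.norm_of_nonneg (by positivity), div_eq_mul_inv (x ^ m)]
      gcongr
      have := exp_pos x
      rw [div_le_iff₀ (by positivity)]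
      field_simp
      linarith
  have hd : ∀ x : ℝ, HasDerivAt (fun v => v ^ m / (1 + exp v))
      (m * (x ^ (m - 1) / (1 + exp x)) - x ^ m * (exp x / (1 + exp x) ^ 2)) x := fun x => by
    have := (hasDerivAt_pow m x).div ((Real.hasDerivAt_exp x).const_add 1) (by positivity)
    refine this.congr_deriv ?_
    have := exp_pos x
    field_simp
  have hlim : Filter.Tendsto (fun v : ℝ => v ^ m / (1 + exp v)) Filter.atTop (nhds 0) := by
    refine squeeze_zero' ?_ ?_ (tendsto_pow_mul_exp_neg_atTop_nhds_zero m)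
    · filter_upwards [Filter.eventually_ge_atTop 0] with x hx
      positivity
    · filter_upwards [Filter.eventually_ge_atTop 0] with x hx
      rw [exp_neg, div_eq_mul_inv]
      gcongr
      linarith
  have hI := integral_Ioi_of_hasDerivAt_of_tendsto' (a := 0) (fun x _ => hd x)
    (((HI_eta0 (m - 1)).const_mul _).sub hInt) hlim
  rw [integral_sub ((HI_eta0 (m - 1)).const_mul _) hInt, integral_const_mul] at hI
  have h := HI.sym (a := _) (g := fun v => v ^ m * (exp v / (1 + exp v) ^ 2)) ((-1) ^ m) ⟨hInt, rfl⟩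
    (fun x hx => rfl) (fun x hx => by
      have := exp_pos x
      rw [neg_pow, exp_neg]
      field_simp
      ring)
  convert h using 1
  rcases Nat.even_or_odd m with h' | h'
  · by_cases h0 : m = 0
    · subst h0
      rw [cc_zero]
      norm_num at hI ⊢
      rw [hI]; norm_num
    · obtain ⟨k, rfl⟩ := Nat.exists_eq_succ_of_ne_zero h0
      simp only [Nat.succ_eq_add_one] at *
      have hk : Odd k := by
        rw [← Nat.not_even_iff_odd]; intro h2; exact (Nat.not_even_iff_odd.mpr h2.add_one) h'
      have h3 := (HI_eta k hk.pos).2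
      rw [zeta_val k hk] at h3
      simp only [Nat.add_sub_cancel, h3] at hI
      rw [h'.neg_one_pow, cc, Nat.factorial_succ]
      simp only [zero_pow h0, zero_div, sub_zero] at hI
      push_cast at hI ⊢
      linear_combination 2 * hI
  · rw [cc_odd h', h'.neg_one_pow]; ring


lemma HI_ico {a b : ℝ} (hab : a ≤ b) {g : ℝ → ℝ} (hg : Continuous g) :
    HI volume ((Set.Ico a b).indicator g) (∫ x in a..b, g x) := by
  constructor
  · rw [integrable_indicator_iff measurableSet_Ico]
    exact (hg.integrableOn_Icc).mono_set Set.Ico_subset_Icc_self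
  · rw [integral_indicator measurableSet_Ico, intervalIntegral.integral_of_le hab,
      integral_Ico_eq_integral_Ioc]

lemma HI_k3 (m : ℕ) (u : ℝ) :
    HI volume (fun v => (v ^ m - u ^ m) * ((if v < 0 then 1 else 0) - (if v < u then 1 else 0)))
      (u ^ (m + 1) - u ^ (m + 1) / (m + 1)) := by
  have hc : Continuous fun v : ℝ => v ^ m - u ^ m := by fun_prop
  rcases le_total u 0 with h | h
  · have := HI_ico h hc
    convert this using 1
    · ext v
      by_cases h1 : v < 0 <;> by_cases h2 : v < u <;> simp [h1, h2, Set.indicator]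
      all_goals (exfalso; linarith)
    · simp
      ring
  · have := (HI_ico h hc).const_mul (-1)
    convert this using 1
    · ext v
      by_cases h1 : v < 0 <;> by_cases h2 : v < u <;> simp [h1, h2, Set.indicator]
      all_goals (exfalso; linarith)
    · simp
      ring

/-- value of `T` on the monomials, in the logit coordinate -/
noncomputable def tm (m : ℕ) (u : ℝ) : ℝ :=
  u ^ (m + 1) - u ^ (m + 1) / (m + 1)
    - ∑ j ∈ Finset.range m, (m.choose (j + 1)) * u ^ (m - (j + 1)) * ((j + 1).factorial * dd (j + 2))
    + m.factorial * cc (m + 1)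

/-- the kernel in the logit coordinate -/
noncomputable def K (u v : ℝ) : ℝ := 1 / (exp (v - u) - 1) + 1 / (1 + exp v)

lemma HI.shift {f : ℝ → ℝ} {a : ℝ} (hf : HI volume f a) (u : ℝ) :
    HI volume (fun v => f (v - u)) a :=
  ⟨hf.1.comp_sub_right u, by rw [integral_sub_right_eq_self f u, hf.2]⟩

lemma HI_mono (m : ℕ) (u : ℝ) : HI volume (fun v => (v ^ m - u ^ m) * K u v) (tm m u) := by
  have h1 : HI volume (fun v => ∑ j ∈ Finset.range m, (m.choose (j + 1)) * u ^ (m - (j + 1)) *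
      ((v - u) ^ (j + 1) * k1 (v - u))) (∑ j ∈ Finset.range m, (m.choose (j + 1)) *
        u ^ (m - (j + 1)) * (-((j + 1).factorial * dd (j + 2)))) :=
    HI.sum fun j _ => ((HI_k1 (j + 1) (by omega)).shift u).const_mul _
  have h2 := ((h1.add (HI_k2 m)).sub ((HI_k2 0).const_mul (u ^ m))).add (HI_k3 m u)
  convert h2 using 1
  · ext v
    have hb : v ^ m - u ^ m = ∑ j ∈ Finset.range m, (m.choose (j + 1)) * u ^ (m - (j + 1)) *
        (v - u) ^ (j + 1) := by
      have := add_pow (v - u) u m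
      rw [Finset.sum_range_succ', sub_add_cancel] at this
      rw [this]
      simp only [pow_zero, Nat.choose_zero_right, Nat.sub_zero, Nat.cast_one, one_mul, mul_one]
      rw [add_sub_cancel_right]
      exact Finset.sum_congr rfl fun j _ => by ring
    have hb2 : ∑ j ∈ Finset.range m, (m.choose (j + 1)) * u ^ (m - (j + 1)) *
        ((v - u) ^ (j + 1) * k1 (v - u)) = (v ^ m - u ^ m) * k1 (v - u) := by
      rw [hb, Finset.sum_mul]
      exact Finset.sum_congr rfl fun j _ => by ring
    rw [hb2, K, k1, k2]
    simp only [sub_neg]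
    ring
  · rw [tm, cc_odd (n := 0 + 1) (by simp)]
    simp only [mul_neg, Finset.sum_neg_distrib]
    ring

lemma sig_logit (v : ℝ) : log (sigmoid v / (1 - sigmoid v)) = v := by
  have h1 := exp_pos (-v)
  have : sigmoid v / (1 - sigmoid v) = exp v := by
    rw [sigmoid_def, exp_neg]
    have := exp_pos v
    field_simp
    ring
  rw [this, log_exp]

lemma cov (g : ℝ → ℝ) : ∫ x in Set.Ioo (0 : ℝ) 1, g x =
    ∫ v, exp v / (1 + exp v) ^ 2 * g (sigmoid v) := by
  have := integral_image_eq_integral_abs_deriv_smul (s := Set.univ) MeasurableSet.univ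
    (fun x _ => (hasDerivAt_sigmoid x).hasDerivWithinAt) sigmoid_injective.injOn g
  rw [Set.image_univ, range_sigmoid] at this
  rw [this, setIntegral_univ]
  refine integral_congr_ae (ae_of_all _ fun v => ?_)
  have h : sigmoid v * (1 - sigmoid v) = exp v / (1 + exp v) ^ 2 := by
    rw [sigmoid_def, exp_neg]
    have := exp_pos v
    field_simp
    ring
  have h2 : 0 ≤ exp v / (1 + exp v) ^ 2 := by positivity
  simp only [h, smul_eq_mul, abs_of_nonneg h2]

lemma kernel_eq (u v : ℝ) (h : v ≠ u) :
    exp v / (1 + exp v) ^ 2 / (sigmoid v - sigmoid u) = K u v := by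
  have hv := exp_pos v
  have hu := exp_pos u
  have h1 : exp v - exp u ≠ 0 := fun h' => h (exp_injective (by linarith))
  have h2 : sigmoid v - sigmoid u = (exp v - exp u) / ((1 + exp v) * (1 + exp u)) := by
    rw [sigmoid_def, sigmoid_def, exp_neg, exp_neg]
    field_simp
    ring
  have h3 : exp (v - u) - 1 = (exp v - exp u) / exp u := by
    rw [exp_sub]; field_simp
  rw [h2, K, h3]
  field_simp
  ring

/-- `T` of a polynomial in the logit function -/
lemma T_poly (N : ℕ) (a : ℕ → ℝ) (f : ℝ → ℝ)
    (hf : ∀ x ∈ Set.Ioo (0 : ℝ) 1, f x = ∑ m ∈ Finset.range N, a m * log (x / (1 - x)) ^ m)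
    (x : ℝ) (hx : x ∈ Set.Ioo (0 : ℝ) 1) :
    T f x = ∑ m ∈ Finset.range N, a m * tm m (log (x / (1 - x))) := by
  obtain ⟨u, rfl⟩ : ∃ u, sigmoid u = x := by
    rw [← range_sigmoid] at hx; exact hx
  have hfs : ∀ v, f (sigmoid v) = ∑ m ∈ Finset.range N, a m * v ^ m := fun v => by
    rw [hf _ ⟨sigmoid_pos v, sigmoid_lt_one v⟩, sig_logit]
  rw [T, cov, sig_logit]
  have h := HI.sum (s := Finset.range N) (fun m _ => (HI_mono m u).const_mul (a m))
  rw [← h.2]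
  refine integral_congr_ae (ae_of_all _ fun v => ?_)
  simp only [hfs]
  by_cases hv : v = u
  · subst hv; simp
  · rw [← kernel_eq u v hv, ← Finset.sum_sub_distrib, Finset.sum_div, Finset.mul_sum]
    exact Finset.sum_congr rfl fun m _ => by ring

lemma I_poly (N : ℕ) (a : ℕ → ℝ) (f : ℝ → ℝ)
    (hf : ∀ x ∈ Set.Ioo (0 : ℝ) 1, f x = ∑ m ∈ Finset.range N, a m * log (x / (1 - x)) ^ m) :
    ∫ x in Set.Ioo (0 : ℝ) 1, f x = ∑ m ∈ Finset.range N, a m * (m.factorial * cc m) := by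
  have hfs : ∀ v, f (sigmoid v) = ∑ m ∈ Finset.range N, a m * v ^ m := fun v => by
    rw [hf _ ⟨sigmoid_pos v, sigmoid_lt_one v⟩, sig_logit]
  rw [cov]
  have h := HI.sum (s := Finset.range N) (fun m _ => (HI_dens m).const_mul (a m))
  rw [← h.2]
  refine integral_congr_ae (ae_of_all _ fun v => ?_)
  simp only [hfs]
  rw [Finset.mul_sum]
  exact Finset.sum_congr rfl fun m _ => by ring

lemma tm_eq (m : ℕ) (u : ℝ) : tm m u = m.factorial * (u ^ (m + 1) / m.factorial + cc (m + 1)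
    - ∑ j ∈ Finset.range (m + 2), dd (m + 1 - j) * (u ^ j / j.factorial)) := by
  have h0 : ∑ j ∈ Finset.range (m + 2), dd (m + 1 - j) * (u ^ j / j.factorial) =
      ∑ j ∈ Finset.range (m + 2), dd j * (u ^ (m + 1 - j) / (m + 1 - j).factorial) := by
    rw [← Finset.sum_range_reflect]
    refine Finset.sum_congr rfl fun j hj => ?_
    have := Finset.mem_range.mp hj
    rw [show m + 2 - 1 - j = m + 1 - j by omega, show m + 1 - (m + 1 - j) = j by omega]
  rw [h0, Finset.sum_range_succ', Finset.sum_range_succ', tm, dd_zero, dd_odd (n := 0 + 1) (by simp)]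
  have hm : (m.factorial : ℝ) ≠ 0 := by positivity
  have hm1 : ((m + 1).factorial : ℝ) = (m + 1) * m.factorial := by
    rw [Nat.factorial_succ]; push_cast; ring
  have hs : ∑ j ∈ Finset.range m, (m.choose (j + 1)) * u ^ (m - (j + 1)) *
      ((j + 1).factorial * dd (j + 2)) = m.factorial * ∑ j ∈ Finset.range m,
        dd (j + 1 + 1) * (u ^ (m + 1 - (j + 1 + 1)) / (m + 1 - (j + 1 + 1)).factorial) := by
    rw [Finset.mul_sum]
    refine Finset.sum_congr rfl fun j hj => ?_
    have hj := Finset.mem_range.mp hj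
    rw [show m + 1 - (j + 1 + 1) = m - (j + 1) by omega, Nat.cast_choose ℝ (by omega : j + 1 ≤ m)]
    field_simp
  rw [hs, Nat.sub_zero, hm1]
  have : (m : ℝ) + 1 ≠ 0 := by positivity
  field_simp
  ring

/-- coefficients of `T^k φ₀` as polynomial in the logit -/
noncomputable def pc (k m : ℕ) : ℝ :=
  k.factorial * (cc (k + 1 - m) / m.factorial - if m = 0 then dd (k + 1) else 0)

lemma triple (N : ℕ) (v : ℕ → ℝ) :
    ∑ p ∈ Finset.range (N + 1), cc (N - p) * ∑ j ∈ Finset.range (p + 1), dd (p - j) * v j =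
      ∑ j ∈ Finset.range (N + 1), (1 - ((N : ℝ) - j)) * cc (N - j) * v j := by
  have h := congrArg (PowerSeries.coeff N)
    (mul_assoc (PowerSeries.mk v) (PowerSeries.mk dd) (PowerSeries.mk cc))
  rw [PowerSeries.coeff_mul, PowerSeries.coeff_mul,
    Finset.Nat.sum_antidiagonal_eq_sum_range_succ_mk,
    Finset.Nat.sum_antidiagonal_eq_sum_range_succ_mk] at h
  simp only [PowerSeries.coeff_mk, Nat.succ_eq_add_one] at h
  have hL : ∀ p, PowerSeries.coeff p (PowerSeries.mk v * PowerSeries.mk dd) =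
      ∑ j ∈ Finset.range (p + 1), dd (p - j) * v j := fun p => by
    rw [PowerSeries.coeff_mul, Finset.Nat.sum_antidiagonal_eq_sum_range_succ_mk]
    simp only [PowerSeries.coeff_mk, Nat.succ_eq_add_one]
    exact Finset.sum_congr rfl fun j _ => mul_comm _ _
  have hR : ∀ p, PowerSeries.coeff p (PowerSeries.mk dd * PowerSeries.mk cc) =
      (1 - p) * cc p := fun p => by
    rw [mul_comm, PowerSeries.coeff_mul, ← conv_cd]
    simp only [PowerSeries.coeff_mk]
  simp only [hL, hR] at h
  rw [Finset.sum_congr rfl fun p _ => mul_comm (cc (N - p)) _, h]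
  refine Finset.sum_congr rfl fun j hj => ?_
  rw [Nat.cast_sub (by have := Finset.mem_range.mp hj; omega)]
  ring

lemma poly_step (k : ℕ) (u : ℝ) : ∑ m ∈ Finset.range (k + 2), pc k m * tm m u =
    ∑ m ∈ Finset.range (k + 3), pc (k + 1) m * u ^ m := by
  have h0 : tm 0 u = 0 := by simp [tm, cc_odd]
  have hL : ∀ m ∈ Finset.range (k + 2), pc k m * tm m u = k.factorial *
      (cc (k + 2 - (m + 1)) * (((m + 1 : ℕ) : ℝ) * (u ^ (m + 1) / (m + 1).factorial))
        + cc (m + 1) * cc (k + 2 - (m + 1))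
        - cc (k + 2 - (m + 1)) *
          ∑ j ∈ Finset.range (m + 1 + 1), dd (m + 1 - j) * (u ^ j / j.factorial)) := by
    intro m _
    have e : pc k m * tm m u = k.factorial * (cc (k + 1 - m) / m.factorial) * tm m u := by
      by_cases hm : m = 0
      · subst hm; rw [h0]; ring
      · simp [pc, hm]
    rw [e, tm_eq, show k + 2 - (m + 1) = k + 1 - m by omega, Nat.factorial_succ]
    have : (m.factorial : ℝ) ≠ 0 := by positivity
    push_cast
    field_simp
  have h3 := triple (k + 2) fun j => u ^ j / j.factorial
  have h2 := conv_cc (k + 2)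
  rw [Finset.Nat.sum_antidiagonal_eq_sum_range_succ_mk] at h2
  simp only [Nat.succ_eq_add_one] at h2
  have h1 : ∑ j ∈ Finset.range (k + 2 + 1), cc (k + 2 - j) * ((j : ℝ) * (u ^ j / j.factorial)) =
    ∑ m ∈ Finset.range (k + 2),
      cc (k + 2 - (m + 1)) * (((m + 1 : ℕ) : ℝ) * (u ^ (m + 1) / (m + 1).factorial)) := by
    rw [Finset.sum_range_succ']; simp
  rw [Finset.sum_range_succ'] at h2
  rw [Finset.sum_range_succ'] at h3
  rw [Finset.sum_congr rfl hL, ← Finset.mul_sum, Finset.sum_sub_distrib, Finset.sum_add_distrib,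
    ← h1, eq_sub_of_add_eq h2, eq_sub_of_add_eq h3]
  have hR : ∑ m ∈ Finset.range (k + 3), pc (k + 1) m * u ^ m =
      (k + 1).factorial * (∑ m ∈ Finset.range (k + 2 + 1), cc (k + 2 - m) * (u ^ m / m.factorial))
        - (k + 1).factorial * dd (k + 2) := by
    have : ∀ m ∈ Finset.range (k + 3), pc (k + 1) m * u ^ m =
        (k + 1).factorial * (cc (k + 2 - m) * (u ^ m / m.factorial)) -
          (k + 1).factorial * if m = 0 then dd (k + 2) else 0 := by
      intro m _
      by_cases hm : m = 0
      · subst hm; simp [pc]; ring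
      · simp [pc, hm]; ring
    rw [Finset.sum_congr rfl this, Finset.sum_sub_distrib, ← Finset.mul_sum, ← Finset.mul_sum]
    simp
  have hS : ∑ j ∈ Finset.range (k + 2 + 1), (1 - (((k + 2 : ℕ) : ℝ) - j)) * cc (k + 2 - j) *
      (u ^ j / j.factorial) =
      ∑ j ∈ Finset.range (k + 2 + 1), cc (k + 2 - j) * ((j : ℝ) * (u ^ j / j.factorial))
      - (k + 1) * ∑ m ∈ Finset.range (k + 2 + 1), cc (k + 2 - m) * (u ^ m / m.factorial) := by
    rw [Finset.mul_sum, ← Finset.sum_sub_distrib]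
    refine Finset.sum_congr rfl fun j _ => ?_
    push_cast; ring
  rw [hR, hS, Nat.factorial_succ]
  simp [cc_zero, dd_zero]
  ring

lemma iter (k : ℕ) : ∀ x ∈ Set.Ioo (0 : ℝ) 1, (T^[k] fun y => Real.log (y / (1 - y))) x =
    ∑ m ∈ Finset.range (k + 2), pc k m * log (x / (1 - x)) ^ m := by
  induction k with
  | zero =>
    intro x hx
    simp [Finset.sum_range_succ, pc, cc_zero, cc_odd, dd_odd]
  | succ k ih =>
    intro x hx
    rw [Function.iterate_succ_apply', T_poly _ _ _ ih x hx, poly_step]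

lemma final (k : ℕ) : ∫ x in Set.Ioo (0 : ℝ) 1, (T^[k] fun y => Real.log (y / (1 - y))) x =
    - ((k + 1).factorial * dd (k + 1)) := by
  rw [I_poly _ _ _ (iter k)]
  have h := conv_cc (k + 1)
  rw [Finset.Nat.sum_antidiagonal_eq_sum_range_succ_mk] at h
  have h2 : ∀ m ∈ Finset.range (k + 2), pc k m * (m.factorial * cc m) =
      k.factorial * (cc m * cc (k + 1 - m)) - k.factorial * if m = 0 then dd (k + 1) else 0 := by
    intro m hm
    by_cases h0 : m = 0
    · subst h0; simp [pc, cc_zero]; ring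
    · simp only [pc, h0, if_false]; field_simp; ring
  rw [Finset.sum_congr rfl h2, Finset.sum_sub_distrib, ← Finset.mul_sum, ← Finset.mul_sum]
  simp only [Nat.succ_eq_add_one] at h
  rw [h]
  simp [Nat.factorial_succ]
  ring

theorem stmt18 (n : ℕ) (hn : 1 ≤ n) :
    ∫ x in Set.Ioo (0 : ℝ) 1, (T^[2 * n - 1] fun y => Real.log (y / (1 - y))) x =
      (-1 : ℝ) ^ (n + 1) * 4 ^ n * ((bernoulli (2 * n) : ℚ) : ℝ) * Real.pi ^ (2 * n) := by
  rw [final, show 2 * n - 1 + 1 = 2 * n by omega, dd, if_pos (by simp),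
    show 2 * n / 2 = n by omega]
  have : ((2 * n).factorial : ℝ) ≠ 0 := by positivity
  rw [mul_div_cancel₀ _ this, mul_pow, pow_mul 2 2 n]
  norm_num
  ring
end
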